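/- arXiv:1707.07417 — 3 statements merged into one kernel-verified Lean document; each statement's English description precedes it below -/
import Mathlib

section
/- Let X be an ACM finite set of points in P^1 × P^n. Then there exists a set of generators G(I_X) of the ideal I_X ⊆ R = k[x_0, x_1, y_0,...,y_n] such that every F ∈ G(I_X) factors as F = F'·F'' where F' has bidegree (a,0) and F'' has bidegree (0,b) for some a,b ∈ N; that is, F' ∈ k[x_0,x_1] and F'' ∈ k[y_0,...,y_n]. Moreover, F' is a product of linear forms of degree (1,0), each defining a hyperplane (point of P^1) containing a level set of X. -/
noncomputable section

/-- Points of projective `m`-space over the field `k`. -/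
abbrev Pt (k : Type) [Field k] (m : ℕ) := Projectivization k (Fin (m + 1) → k)

set_option synthInstance.maxHeartbeats 1000000 in
/-- An ideal `I` of a polynomial ring defines an *arithmetically Cohen–Macaulay* (ACM)
quotient if there is a regular sequence on `R/I`, consisting of elements of the irrelevant
maximal ideal (generated by the images of the variables), whose length equals the Krull
dimension of `R/I`.  For a graded quotient of a polynomial ring this says exactly that the
depth of the irrelevant maximal ideal on `R/I` equals the Krull dimension, i.e. that `R/I`
is a Cohen–Macaulay ring. -/
def IsACM {k : Type} [Field k] {σ : Type} (I : Ideal (MvPolynomial σ k)) : Prop :=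
  ∃ rs : List (MvPolynomial σ k ⧸ I),
    (∀ r ∈ rs,
      r ∈ Ideal.map (Ideal.Quotient.mk I)
            (Ideal.span (Set.range (MvPolynomial.X : σ → MvPolynomial σ k)))) ∧
    RingTheory.Sequence.IsRegular (MvPolynomial σ k ⧸ I) rs ∧
    (rs.length : WithBot ℕ∞) = ringKrullDim (MvPolynomial σ k ⧸ I)

variable (k : Type) [Field k]

/-- The homogeneous (saturated) vanishing ideal of a set of points of `ℙ^m`:
all polynomials vanishing on the affine cone over the points. -/
def vanishP {m : ℕ} (Z : Set (Pt k m)) : Ideal (MvPolynomial (Fin (m + 1)) k) :=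
  ⨅ (q : Pt k m) (_ : q ∈ Z) (s : k),
    RingHom.ker (MvPolynomial.eval (s • q.rep))

/-- The bihomogeneous (saturated) vanishing ideal of a set of points of `ℙ^a × ℙ^b`:
all polynomials vanishing on the multicone over the points. -/
def vanishP2 {a b : ℕ} (X : Set (Pt k a × Pt k b)) :
    Ideal (MvPolynomial (Fin (a + 1) ⊕ Fin (b + 1)) k) :=
  ⨅ (p : Pt k a × Pt k b) (_ : p ∈ X) (s : k) (t : k),
    RingHom.ker (MvPolynomial.eval (Sum.elim (s • p.1.rep) (t • p.2.rep)))

/-- The `(⋆)`-property for a finite set of points in `ℙ^a × ℙ^b`. -/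
def StarProp {a b : ℕ} (X : Set (Pt k a × Pt k b)) : Prop :=
  ∀ p ∈ X, ∀ q ∈ X, (p.1, q.2) ∈ X ∨ (q.1, p.2) ∈ X

section Auxiliary

open MvPolynomial

/-- A finite family of functionals, ordered by decreasing value of `μ`, contains a subfamily
admitting dual vectors and having the same common kernels on every upper segment. -/
theorem exists_dual_subfamily {K V ι : Type*} [Field K] [AddCommGroup V] [Module K V]
    (ev : ι → V →ₗ[K] K) (μ : ι → ℕ) (D : Finset ι) :
    ∃ B ⊆ D, ∃ e : ι → V,
      (∀ i ∈ B, ev i (e i) = 1) ∧ (∀ i ∈ B, ∀ j ∈ B, i ≠ j → ev i (e j) = 0) ∧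
      ∀ i ∈ D, ∀ v : V, (∀ j ∈ B, μ i ≤ μ j → ev j v = 0) → ev i v = 0 := by
  classical
  induction D using Finset.induction_on_min_value μ with
  | empty => exact ⟨∅, by simp, 0, by simp, by simp, by simp⟩
  | insert a s has hmin ih =>
    obtain ⟨B, hBs, e, he1, he0, hcl⟩ := ih
    by_cases h : ∀ v : V, (∀ j ∈ B, ev j v = 0) → ev a v = 0
    · refine ⟨B, hBs.trans (Finset.subset_insert _ _), e, he1, he0, ?_⟩
      intro i hi v hv
      rcases Finset.mem_insert.1 hi with rfl | hi
      · exact h v fun j hj => hv j hj (hmin j (hBs hj))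
      · exact hcl i hi v hv
    · push Not at h
      obtain ⟨v₀, hv₀, hav₀⟩ := h
      have haB : a ∉ B := fun h => has (hBs h)
      set w := (ev a v₀)⁻¹ • v₀ with hw
      have haw : ev a w = 1 := by simp [hw, hav₀]
      have hBw : ∀ j ∈ B, ev j w = 0 := fun j hj => by simp [hw, hv₀ j hj]
      have hne : ∀ j ∈ B, j ≠ a := fun j hj h => haB (h ▸ hj)
      refine ⟨insert a B, Finset.insert_subset_insert _ hBs,
        fun i => if i = a then w else e i - ev a (e i) • w, ?_, ?_, ?_⟩
      · intro i hi
        rcases Finset.mem_insert.1 hi with rfl | hi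
        · simp [haw]
        · simp [hne i hi, he1 i hi, hBw i hi]
      · intro i hi j hj hij
        rcases Finset.mem_insert.1 hi with rfl | hiB <;> rcases Finset.mem_insert.1 hj with rfl | hjB
        · exact absurd rfl hij
        · simp [hne j hjB, haw]
        · simp [hBw i hiB]
        · simp [hne j hjB, he0 i hiB j hjB hij, hBw i hiB]
      · intro i hi v hv
        rcases Finset.mem_insert.1 hi with rfl | hi
        · exact hv i (Finset.mem_insert_self _ _) le_rfl
        · exact hcl i hi v fun j hj => hv j (Finset.mem_insert_of_mem hj)

/-- If `r₁, r₂` is a weakly regular sequence and `L` is a nonzerodivisor, then an element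
multiplied into `(L)` by powers of `r₁` and `r₂` lies in `(L)`. -/
theorem dvd_of_dvd_pow_mul {S : Type*} [CommRing S] {r₁ r₂ L u : S}
    (h₁ : ∀ x, r₁ * x = 0 → x = 0) (h₂ : ∀ x, r₁ ∣ r₂ * x → r₁ ∣ x)
    (hL : ∀ x, L * x = 0 → x = 0) {M N : ℕ} (hu₁ : L ∣ r₁ ^ M * u) (hu₂ : L ∣ r₂ ^ N * u) :
    L ∣ u := by
  have h₁' : ∀ M x, r₁ ^ M * x = 0 → x = 0 := by
    intro M
    induction M with
    | zero => simp
    | succ M ih => intro x hx; exact h₁ x (ih _ (by rw [← hx]; ring))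
  have h₂' : ∀ N x, r₁ ∣ r₂ ^ N * x → r₁ ∣ x := by
    intro N
    induction N with
    | zero => simp
    | succ N ih => intro x hx; exact h₂ x (ih _ (by convert hx using 1; ring))
  have h₃ : ∀ M x, r₁ ^ M ∣ r₂ ^ N * x → r₁ ^ M ∣ x := by
    intro M
    induction M with
    | zero => simp
    | succ M ih =>
      intro x hx
      obtain ⟨y, rfl⟩ := h₂' N x (dvd_trans ⟨r₁ ^ M, by ring⟩ hx)
      obtain ⟨z, hz⟩ := hx
      obtain ⟨w, rfl⟩ := ih y ⟨z, by
        rw [← sub_eq_zero]; apply h₁; linear_combination hz⟩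
      exact ⟨w, by ring⟩
  obtain ⟨v, hv⟩ := hu₁
  obtain ⟨w, hw⟩ := hu₂
  obtain ⟨v', rfl⟩ := h₃ M v ⟨w, by
    rw [← sub_eq_zero]; apply hL; linear_combination r₁ ^ M * hw - r₂ ^ N * hv⟩
  exact ⟨v', by rw [← sub_eq_zero]; apply h₁' M; linear_combination hv⟩

open scoped Pointwise in
/-- The first two members of a weakly regular sequence, expressed through divisibility. -/
theorem exists_regular_pair {S : Type*} [CommRing S] {rs : List S}
    (h : RingTheory.Sequence.IsWeaklyRegular S rs) (hlen : 2 ≤ rs.length) :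
    ∃ r₁ ∈ rs, ∃ r₂ ∈ rs,
      (∀ x, r₁ * x = 0 → x = 0) ∧ ∀ x, r₁ ∣ r₂ * x → r₁ ∣ x := by
  match rs, hlen with
  | r₁ :: r₂ :: rs, _ =>
    rw [RingTheory.Sequence.isWeaklyRegular_cons_iff,
      RingTheory.Sequence.isWeaklyRegular_cons_iff] at h
    obtain ⟨h₁, h₂, -⟩ := h
    refine ⟨r₁, by simp, r₂, by simp, fun x hx => h₁ (by simpa using hx), fun x hx => ?_⟩
    have := (isSMulRegular_quotient_iff_mem_of_smul_mem (r₁ • (⊤ : Submodule S S)) r₂).1 h₂ x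
    simp only [Submodule.mem_smul_pointwise_iff_exists, Submodule.mem_top, true_and,
      smul_eq_mul] at this
    obtain ⟨y, hy⟩ := hx
    obtain ⟨z, hz⟩ := this ⟨y, hy.symm⟩
    exact ⟨z, hz.symm⟩

variable {k : Type} [Field k]

/-- The linear form on `ℙ¹` vanishing at a given point. -/
def pointForm (P : Pt k 1) : MvPolynomial (Fin (1 + 1)) k :=
  C (P.rep 1) * X 0 - C (P.rep 0) * X 1

/-- Restriction of forms on `ℙ¹` to the affine line over a point. -/
def lineHom (P : Pt k 1) : MvPolynomial (Fin (1 + 1)) k →ₐ[k] Polynomial k :=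
  aeval fun i => Polynomial.C (P.rep i) * Polynomial.X

theorem pointForm_isHomogeneous (P : Pt k 1) : (pointForm P).IsHomogeneous 1 := by
  have h (c : k) (i : Fin (1 + 1)) : (C c * X i : MvPolynomial (Fin (1 + 1)) k).IsHomogeneous 1 := by
    simpa using (isHomogeneous_C _ c).mul (isHomogeneous_X k i)
  exact (h _ _).sub (h _ _)

theorem eval_smul_pointForm (P : Pt k 1) (s : k) : eval (s • P.rep) (pointForm P) = 0 := by
  simp [pointForm]; ring

theorem eq_of_det_eq_zero {P P' : Pt k 1}
    (h : P'.rep 1 * P.rep 0 - P'.rep 0 * P.rep 1 = 0) : P = P' := by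
  rw [← P.mk_rep, ← P'.mk_rep, Projectivization.mk_eq_mk_iff']
  have hP' := P'.rep_nonzero
  by_cases h0 : P'.rep 0 = 0
  · have h1 : P'.rep 1 ≠ 0 := fun h1 => hP' (by ext i; fin_cases i <;> simp [h0, h1])
    refine ⟨P.rep 1 / P'.rep 1, ?_⟩
    have : P.rep 0 = 0 := by simpa [h0, h1] using h
    ext i; fin_cases i <;> simp [h0, h1, this]
  · refine ⟨P.rep 0 / P'.rep 0, ?_⟩
    ext i; fin_cases i
    · simp [h0]
    · simp only [Nat.reduceAdd, Fin.mk_one, Pi.smul_apply, smul_eq_mul]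
      field_simp
      linear_combination h

theorem pointForm_dvd_of_lineHom_eq_zero {P : Pt k 1} {f : MvPolynomial (Fin (1 + 1)) k}
    (hf : lineHom P f = 0) : pointForm P ∣ f := by
  obtain ⟨a₀, a₁, ha⟩ : ∃ a₀ a₁ : k, a₀ * P.rep 0 + a₁ * P.rep 1 = 1 := by
    by_cases h0 : P.rep 0 = 0
    · have h1 : P.rep 1 ≠ 0 := fun h1 => P.rep_nonzero (by ext i; fin_cases i <;> simp [h0, h1])
      exact ⟨0, (P.rep 1)⁻¹, by simp [h1]⟩
    · exact ⟨(P.rep 0)⁻¹, 0, by simp [h0]⟩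
  let π := Ideal.Quotient.mkₐ k (Ideal.span {pointForm P})
  let ψ : Polynomial k →ₐ[k] MvPolynomial (Fin (1 + 1)) k ⧸ Ideal.span {pointForm P} :=
    Polynomial.aeval (π (C a₀ * X 0 + C a₁ * X 1))
  have haC : (C a₀ * C (P.rep 0) + C a₁ * C (P.rep 1) : MvPolynomial (Fin (1 + 1)) k) = 1 := by
    rw [← C_mul, ← C_mul, ← C_add, ha, C_1]
  have hcomp : ψ.comp (lineHom P) = π := by
    apply MvPolynomial.algHom_ext
    intro i
    have hC (c : k) : algebraMap k (MvPolynomial (Fin (1 + 1)) k ⧸ Ideal.span {pointForm P}) c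
        = π (C c) := rfl
    simp only [lineHom, AlgHom.comp_apply, aeval_X, map_mul, ψ, Polynomial.aeval_C,
      Polynomial.aeval_X, hC]
    rw [← map_mul]
    refine Ideal.Quotient.eq.2 (Ideal.mem_span_singleton.2 ?_)
    fin_cases i
    · exact ⟨-C a₁, by simp only [pointForm, Fin.zero_eta]; linear_combination X 0 * haC⟩
    · exact ⟨C a₀, by simp only [pointForm, Fin.mk_one]; linear_combination X 1 * haC⟩
  rw [← Ideal.mem_span_singleton, ← Ideal.Quotient.eq_zero_iff_mem]
  change π f = 0
  rw [← hcomp, AlgHom.comp_apply, hf, map_zero]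

theorem lineHom_pointForm_ne_zero {P P' : Pt k 1} (h : P ≠ P') :
    lineHom P (pointForm P') ≠ 0 := by
  intro h0
  apply h
  apply eq_of_det_eq_zero
  have := congrArg (Polynomial.eval 1) h0
  simpa [lineHom, pointForm, algebraMap_eq] using this

theorem prod_pointForm_dvd (S : Finset (Pt k 1)) {f : MvPolynomial (Fin (1 + 1)) k}
    (hf : ∀ P ∈ S, lineHom P f = 0) : ∏ P ∈ S, pointForm P ∣ f := by
  classical
  induction S using Finset.induction_on generalizing f with
  | empty => simp
  | insert P S hPS ih =>
    obtain ⟨g, rfl⟩ := pointForm_dvd_of_lineHom_eq_zero (hf P (Finset.mem_insert_self _ _))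
    rw [Finset.prod_insert hPS]
    refine mul_dvd_mul_left _ (ih fun P' hP' => ?_)
    have := hf P' (Finset.mem_insert_of_mem hP')
    rw [map_mul] at this
    exact (mul_eq_zero.1 this).resolve_left
      (lineHom_pointForm_ne_zero fun h => hPS (h ▸ hP'))

theorem exists_eq_C_mul_prod_pointForm (S : Finset (Pt k 1)) {f : MvPolynomial (Fin (1 + 1)) k}
    {c : ℕ} (hS : ∏ P ∈ S, pointForm P ≠ 0) (hc : c ≤ S.card) (hfc : f.IsHomogeneous c)
    (hf : ∀ P ∈ S, lineHom P f = 0) : ∃ κ : k, f = C κ * ∏ P ∈ S, pointForm P := by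
  obtain ⟨g, rfl⟩ := prod_pointForm_dvd S hf
  by_cases hg : g = 0
  · exact ⟨0, by simp [hg]⟩
  have h1 := totalDegree_mul_of_isDomain hS hg
  rw [hfc.totalDegree (mul_ne_zero hS hg), IsHomogeneous.totalDegree
    (IsHomogeneous.prod S _ (fun _ => 1) fun P _ => pointForm_isHomogeneous P) hS] at h1
  have h2 : g.totalDegree = 0 := by simp at h1; omega
  refine ⟨coeff 0 g, ?_⟩
  rw [← totalDegree_eq_zero_iff_eq_C.1 h2, mul_comm]

/-- The bidegrees of the variables of the coordinate ring of `ℙ¹ × ℙⁿ`. -/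
def bidegree {n : ℕ} : Fin (1 + 1) ⊕ Fin (n + 1) → ℕ × ℕ :=
  Sum.elim (fun _ => (1, 0)) (fun _ => (0, 1))

theorem weight_bidegree {n : ℕ} (d : Fin (1 + 1) ⊕ Fin (n + 1) →₀ ℕ) :
    Finsupp.weight bidegree d = (∑ i, d (Sum.inl i), ∑ j, d (Sum.inr j)) := by
  rw [Finsupp.weight_apply, Finsupp.sum_fintype _ _ (by simp), Fintype.sum_sum_type]
  ext <;> simp [bidegree, Prod.fst_sum, Prod.snd_sum]

/-- Restriction of polynomials to the plane spanned by the two vectors `x` and `y`. -/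
def planeHom {n : ℕ} (x : Fin (1 + 1) → k) (y : Fin (n + 1) → k) :
    MvPolynomial (Fin (1 + 1) ⊕ Fin (n + 1)) k →ₐ[k] MvPolynomial (Fin 2) k :=
  aeval (Sum.elim (fun i => C (x i) * X 0) (fun j => C (y j) * X 1))

theorem eval_planeHom {n : ℕ} (x : Fin (1 + 1) → k) (y : Fin (n + 1) → k) (v : Fin 2 → k)
    (f : MvPolynomial (Fin (1 + 1) ⊕ Fin (n + 1)) k) :
    eval v (planeHom x y f) = eval (Sum.elim (v 0 • x) (v 1 • y)) f := by
  have : ((aeval v : MvPolynomial (Fin 2) k →ₐ[k] k).comp (planeHom x y)) =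
      (aeval (Sum.elim (v 0 • x) (v 1 • y)) : _ →ₐ[k] k) := by
    apply MvPolynomial.algHom_ext
    rintro (i | j) <;> simp [planeHom, mul_comm]
  simpa [coe_aeval_eq_eval] using DFunLike.congr_fun this f

theorem planeHom_monomial {n : ℕ} (x : Fin (1 + 1) → k) (y : Fin (n + 1) → k)
    (d : Fin (1 + 1) ⊕ Fin (n + 1) →₀ ℕ) (c : k) :
    planeHom x y (monomial d c) =
      monomial (Finsupp.single 0 (Finsupp.weight bidegree d).1 +
        Finsupp.single 1 (Finsupp.weight bidegree d).2) (eval (Sum.elim x y) (monomial d c)) := by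
  rw [weight_bidegree, planeHom, aeval_monomial, eval_monomial, Finsupp.prod_fintype _ _ (by simp),
    Finsupp.prod_fintype _ _ (by simp), Fintype.prod_sum_type, Fintype.prod_sum_type]
  simp only [Sum.elim_inl, Sum.elim_inr, mul_pow, Finset.prod_mul_distrib, Finset.prod_pow_eq_pow_sum]
  rw [monomial_add_single, ← C_mul_X_pow_eq_monomial, algebraMap_eq]
  simp only [C_mul, map_prod, map_pow]
  ring

theorem coeff_planeHom {n : ℕ} (x : Fin (1 + 1) → k) (y : Fin (n + 1) → k) (a b : ℕ)
    (f : MvPolynomial (Fin (1 + 1) ⊕ Fin (n + 1)) k) :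
    coeff (Finsupp.single 0 a + Finsupp.single 1 b) (planeHom x y f) =
      eval (Sum.elim x y) (weightedHomogeneousComponent bidegree (a, b) f) := by
  induction f using MvPolynomial.induction_on' with
  | add p q hp hq => simp [hp, hq]
  | monomial d c =>
    rw [planeHom_monomial, coeff_monomial, weightedHomogeneousComponent_of_mem
      (isWeightedHomogeneous_monomial bidegree d c rfl)]
    have : (Finsupp.single (0 : Fin 2) (Finsupp.weight bidegree d).1 +
        Finsupp.single 1 (Finsupp.weight bidegree d).2 = Finsupp.single 0 a + Finsupp.single 1 b) ↔
        (a, b) = Finsupp.weight bidegree d := by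
      constructor
      · intro h
        have h0 := DFunLike.congr_fun h 0
        have h1 := DFunLike.congr_fun h 1
        simp at h0 h1
        ext <;> simp [h0, h1]
      · intro h
        rw [← h]
    simp only [this]
    split_ifs <;> simp

section Ideal

variable {n : ℕ} {Z : Set (Pt k 1 × Pt k n)}

theorem mem_vanishP2_iff {f : MvPolynomial (Fin (1 + 1) ⊕ Fin (n + 1)) k} :
    f ∈ vanishP2 k Z ↔
      ∀ p ∈ Z, ∀ s t : k, eval (Sum.elim (s • p.1.rep) (t • p.2.rep)) f = 0 := by
  simp only [vanishP2, Ideal.mem_iInf, RingHom.mem_ker]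

theorem mem_vanishP2_iff_planeHom [Infinite k] {f : MvPolynomial (Fin (1 + 1) ⊕ Fin (n + 1)) k} :
    f ∈ vanishP2 k Z ↔ ∀ p ∈ Z, planeHom p.1.rep p.2.rep f = 0 := by
  rw [mem_vanishP2_iff]
  refine forall₂_congr fun p _ => ⟨fun h => ?_, fun h s t => ?_⟩
  · refine MvPolynomial.funext fun v => ?_
    rw [eval_planeHom, h, map_zero]
  · have := eval_planeHom p.1.rep p.2.rep ![s, t] f
    simpa [h] using this.symm

theorem mem_vanishP2_iff_component [Infinite k] {f : MvPolynomial (Fin (1 + 1) ⊕ Fin (n + 1)) k} :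
    f ∈ vanishP2 k Z ↔ ∀ p ∈ Z, ∀ a b,
      eval (Sum.elim p.1.rep p.2.rep) (weightedHomogeneousComponent bidegree (a, b) f) = 0 := by
  rw [mem_vanishP2_iff_planeHom]
  refine forall₂_congr fun p _ => ⟨fun h a b => ?_, fun h => ?_⟩
  · rw [← coeff_planeHom, h, coeff_zero]
  · ext d
    have hd : d = Finsupp.single 0 (d 0) + Finsupp.single 1 (d 1) := by
      ext i; fin_cases i <;> simp
    rw [hd, coeff_planeHom, h, coeff_zero]

theorem component_mem_vanishP2 [Infinite k] {f : MvPolynomial (Fin (1 + 1) ⊕ Fin (n + 1)) k}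
    (hf : f ∈ vanishP2 k Z) (m : ℕ × ℕ) :
    weightedHomogeneousComponent bidegree m f ∈ vanishP2 k Z := by
  classical
  rw [mem_vanishP2_iff_component] at hf ⊢
  intro p hp a b
  rw [weightedHomogeneousComponent_of_mem
    (weightedHomogeneousComponent_isWeightedHomogeneous m f)]
  split_ifs with h
  · exact h ▸ hf p hp a b
  · simp

theorem eval_smul_of_isHomogeneous {σ : Type*} {f : MvPolynomial σ k} {b : ℕ}
    (hf : f.IsHomogeneous b) (t : k) (y : σ → k) : eval (t • y) f = t ^ b * eval y f := by
  rw [eval_eq, eval_eq, Finset.mul_sum]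
  refine Finset.sum_congr rfl fun d hd => ?_
  have h := hf (mem_support_iff.1 hd)
  rw [Finsupp.weight_apply, Finsupp.sum] at h
  simp only [Pi.one_apply, smul_eq_mul, mul_one] at h
  simp only [Pi.smul_apply, smul_eq_mul, mul_pow, Finset.prod_mul_distrib,
    Finset.prod_pow_eq_pow_sum, h]
  ring

theorem two_le_ringKrullDim [Infinite k] (hZ : Z.Nonempty) :
    2 ≤ ringKrullDim (MvPolynomial (Fin (1 + 1) ⊕ Fin (n + 1)) k ⧸ vanishP2 k Z) := by
  obtain ⟨p, hp⟩ := hZ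
  have hsurj : Function.Surjective (planeHom p.1.rep p.2.rep) := by
    rw [← AlgHom.range_eq_top, eq_top_iff, ← MvPolynomial.adjoin_range_X, Algebra.adjoin_le_iff]
    obtain ⟨i, hi⟩ := Function.ne_iff.1 p.1.rep_nonzero
    obtain ⟨j, hj⟩ := Function.ne_iff.1 p.2.rep_nonzero
    have h0 : planeHom p.1.rep p.2.rep (C (p.1.rep i)⁻¹ * X (Sum.inl i)) = X 0 := by
      simp only [planeHom, map_mul, aeval_C, aeval_X, algebraMap_eq, Sum.elim_inl]
      rw [← mul_assoc, ← C_mul, inv_mul_cancel₀ hi, C_1, one_mul]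
    have h1 : planeHom p.1.rep p.2.rep (C (p.2.rep j)⁻¹ * X (Sum.inr j)) = X 1 := by
      simp only [planeHom, map_mul, aeval_C, aeval_X, algebraMap_eq, Sum.elim_inr]
      rw [← mul_assoc, ← C_mul, inv_mul_cancel₀ hj, C_1, one_mul]
    rintro _ ⟨l, rfl⟩
    fin_cases l
    · exact ⟨_, h0⟩
    · exact ⟨_, h1⟩
  have := ringKrullDim_le_of_surjective
    (Ideal.Quotient.lift (vanishP2 k Z) (planeHom p.1.rep p.2.rep).toRingHom
      fun f hf => mem_vanishP2_iff_planeHom.1 hf p hp)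
    (Ideal.Quotient.lift_surjective_of_surjective _ _ hsurj)
  rw [ringKrullDim_of_isNoetherianRing] at this
  simpa using this

theorem exists_regular_pair_of_isACM [Infinite k] (hACM : IsACM (vanishP2 k Z)) :
    ∃ r₁ r₂ : MvPolynomial (Fin (1 + 1) ⊕ Fin (n + 1)) k ⧸ vanishP2 k Z,
      (∀ r, r = r₁ ∨ r = r₂ → r ∈ Ideal.map (Ideal.Quotient.mk (vanishP2 k Z))
        (Ideal.span (Set.range MvPolynomial.X))) ∧
      (∀ x, r₁ * x = 0 → x = 0) ∧ ∀ x, r₁ ∣ r₂ * x → r₁ ∣ x := by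
  obtain ⟨rs, hmem, hreg, hlen⟩ := hACM
  have hZ : Z.Nonempty := by
    by_contra hZ
    rw [Set.not_nonempty_iff_eq_empty] at hZ
    apply hreg.top_ne_smul
    have h : vanishP2 k Z = ⊤ := by
      rw [Ideal.eq_top_iff_one, mem_vanishP2_iff]
      simp [hZ]
    have : Subsingleton (MvPolynomial (Fin (1 + 1) ⊕ Fin (n + 1)) k ⧸ vanishP2 k Z) :=
      Ideal.Quotient.subsingleton_iff.2 h
    exact Subsingleton.elim _ _
  have h2 : 2 ≤ rs.length := by
    have := two_le_ringKrullDim hZ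
    rw [← hlen] at this
    exact_mod_cast this
  obtain ⟨r₁, h₁, r₂, h₂, hr₁, hr₂⟩ := exists_regular_pair hreg.toIsWeaklyRegular h2
  exact ⟨r₁, r₂, by rintro r (rfl | rfl) <;> exact hmem _ ‹_›, hr₁, hr₂⟩

theorem isWeightedHomogeneous_rename_inr {e : MvPolynomial (Fin (n + 1)) k} {b : ℕ}
    (he : e.IsHomogeneous b) :
    (rename (Sum.inr : Fin (n + 1) → Fin (1 + 1) ⊕ Fin (n + 1)) e).IsWeightedHomogeneous
      bidegree (0, b) := by
  intro d hd
  obtain ⟨u, rfl, hu⟩ := coeff_rename_ne_zero _ _ _ hd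
  have h := he hu
  rw [Finsupp.weight_apply, Finsupp.sum_fintype _ _ (by simp)] at h
  rw [weight_bidegree]
  have h1 (i : Fin (1 + 1)) : (Finsupp.mapDomain Sum.inr u : Fin (1 + 1) ⊕ Fin (n + 1) →₀ ℕ)
      (Sum.inl i) = 0 := Finsupp.mapDomain_of_notMem_range _ _ (by simp)
  have h2 (j : Fin (n + 1)) : (Finsupp.mapDomain Sum.inr u : Fin (1 + 1) ⊕ Fin (n + 1) →₀ ℕ)
      (Sum.inr j) = u j := Finsupp.mapDomain_apply Sum.inr_injective _ _
  simpa [h1, h2] using h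

theorem exists_eq_sum_of_isWeightedHomogeneous
    {f : MvPolynomial (Fin (1 + 1) ⊕ Fin (n + 1)) k} {a b : ℕ}
    (hf : f.IsWeightedHomogeneous bidegree (a, b)) :
    ∃ (A : (Fin (1 + 1) ⊕ Fin (n + 1) →₀ ℕ) → MvPolynomial (Fin (1 + 1)) k)
      (φ : (Fin (1 + 1) ⊕ Fin (n + 1) →₀ ℕ) → MvPolynomial (Fin (n + 1)) k),
      (∀ d ∈ f.support, (A d).IsHomogeneous a ∧ (φ d).IsHomogeneous b) ∧
      f = ∑ d ∈ f.support, rename Sum.inl (A d) * rename Sum.inr (φ d) := by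
  refine ⟨fun d => C (coeff d f) * ∏ i, X i ^ d (Sum.inl i), fun d => ∏ j, X j ^ d (Sum.inr j),
    fun d hd => ?_, ?_⟩
  · have h := hf (mem_support_iff.1 hd)
    rw [weight_bidegree, Prod.mk.injEq] at h
    constructor
    · simpa [h.1] using (isHomogeneous_C (Fin (1 + 1)) (coeff d f)).mul
        (IsHomogeneous.prod Finset.univ (fun i => (X i : MvPolynomial (Fin (1 + 1)) k) ^ d (Sum.inl i))
          (fun i => d (Sum.inl i)) fun i _ => isHomogeneous_X_pow i _)
    · have := IsHomogeneous.prod Finset.univ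
          (fun i => (X i : MvPolynomial (Fin (n + 1)) k) ^ d (Sum.inr i))
          (fun i => d (Sum.inr i)) fun i _ => isHomogeneous_X_pow i _
      rwa [h.2] at this
  · conv_lhs => rw [f.as_sum]
    refine Finset.sum_congr rfl fun d _ => ?_
    rw [monomial_eq, Finsupp.prod_fintype _ _ (by simp), Fintype.prod_sum_type]
    simp [mul_assoc]

/-- Specialization of the second group of variables to a vector. -/
def specHom (y : Fin (n + 1) → k) :
    MvPolynomial (Fin (1 + 1) ⊕ Fin (n + 1)) k →ₐ[k] MvPolynomial (Fin (1 + 1)) k :=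
  aeval (Sum.elim MvPolynomial.X fun j => C (y j))

theorem specHom_rename_inl (y : Fin (n + 1) → k) (g : MvPolynomial (Fin (1 + 1)) k) :
    specHom y (rename Sum.inl g) = g := by
  rw [specHom, aeval_rename, Sum.elim_comp_inl, aeval_X_left_apply]

theorem specHom_rename_inr (y : Fin (n + 1) → k) (g : MvPolynomial (Fin (n + 1)) k) :
    specHom y (rename Sum.inr g) = C (eval y g) := by
  rw [specHom, aeval_rename, Sum.elim_comp_inr]
  have : (aeval fun j => C (y j) : MvPolynomial (Fin (n + 1)) k →ₐ[k] _) =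
      (Algebra.ofId k (MvPolynomial (Fin (1 + 1)) k)).comp (aeval y) := by
    apply MvPolynomial.algHom_ext
    intro j
    simp [Algebra.ofId_apply, algebraMap_eq]
  rw [this]
  simp [Algebra.ofId_apply, algebraMap_eq]

theorem eval_specHom (x : Fin (1 + 1) → k) (y : Fin (n + 1) → k)
    (f : MvPolynomial (Fin (1 + 1) ⊕ Fin (n + 1)) k) :
    eval x (specHom y f) = eval (Sum.elim x y) f := by
  have : ((aeval x : MvPolynomial (Fin (1 + 1)) k →ₐ[k] k).comp (specHom y)) =
      (aeval (Sum.elim x y) : _ →ₐ[k] k) := by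
    apply MvPolynomial.algHom_ext
    rintro (i | j) <;> simp [specHom]
  simpa [coe_aeval_eq_eval] using DFunLike.congr_fun this f

theorem specHom_isHomogeneous {f : MvPolynomial (Fin (1 + 1) ⊕ Fin (n + 1)) k} {a b : ℕ}
    (hf : f.IsWeightedHomogeneous bidegree (a, b)) (y : Fin (n + 1) → k) :
    (specHom y f).IsHomogeneous a := by
  obtain ⟨A, φ, hA, hsum⟩ := exists_eq_sum_of_isWeightedHomogeneous hf
  rw [hsum, map_sum]
  refine IsHomogeneous.sum _ _ _ fun d hd => ?_
  rw [map_mul, specHom_rename_inl, specHom_rename_inr]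
  simpa using (hA d hd).1.mul (isHomogeneous_C _ _)

theorem eval_lineHom (P : Pt k 1) (s : k) (g : MvPolynomial (Fin (1 + 1)) k) :
    (lineHom P g).eval s = eval (s • P.rep) g := by
  have : ((Polynomial.aeval s : Polynomial k →ₐ[k] k).comp (lineHom P)) =
      (aeval (s • P.rep) : _ →ₐ[k] k) := by
    apply MvPolynomial.algHom_ext
    intro i
    simp only [lineHom, AlgHom.comp_apply, aeval_X, map_mul, Polynomial.aeval_C, Polynomial.aeval_X,
      Pi.smul_apply, smul_eq_mul, Algebra.algebraMap_self, RingHom.id_apply]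
    ring
  simpa [coe_aeval_eq_eval, Polynomial.coe_aeval_eq_eval] using DFunLike.congr_fun this g

theorem lineHom_specHom_eq_zero [Infinite k] {f : MvPolynomial (Fin (1 + 1) ⊕ Fin (n + 1)) k}
    (hf : f ∈ vanishP2 k Z) {P : Pt k 1} {Q : Pt k n} (hPQ : (P, Q) ∈ Z) :
    lineHom P (specHom Q.rep f) = 0 := by
  refine Polynomial.funext fun s => ?_
  rw [eval_lineHom, eval_specHom]
  simpa using mem_vanishP2_iff.1 hf _ hPQ s 1

open Classical in
/-- The points of `ℙ¹` lying in `Z` over a given point of `ℙⁿ`. -/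
def fiber (hZ : Z.Finite) (Q : Pt k n) : Finset (Pt k 1) :=
  (hZ.image Prod.fst).toFinset.filter fun P => (P, Q) ∈ Z

theorem mem_fiber {hZ : Z.Finite} {P : Pt k 1} {Q : Pt k n} :
    P ∈ fiber hZ Q ↔ (P, Q) ∈ Z := by
  simp only [fiber, Finset.mem_filter, Set.Finite.mem_toFinset, Set.mem_image, Prod.exists,
    exists_and_right, exists_eq_right, and_iff_right_iff_imp]
  exact fun h => ⟨Q, h⟩

theorem exists_rename_prod_pointForm_eq (c : k) (S : Finset (Pt k 1)) :
    ∃ h : MvPolynomial (Fin (1 + 1) ⊕ Fin (n + 1)) k,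
      rename Sum.inl (∏ P ∈ S, pointForm P) =
        C (∏ P ∈ S, (P.rep 1 * c - P.rep 0)) * X (Sum.inl 1) ^ S.card +
          (X (Sum.inl 0) - C c * X (Sum.inl 1)) * h := by
  classical
  induction S using Finset.induction_on with
  | empty => exact ⟨0, by simp⟩
  | insert P S hPS ih =>
    obtain ⟨h, hh⟩ := ih
    rw [Finset.prod_insert hPS, Finset.prod_insert hPS, Finset.card_insert_of_notMem hPS, map_mul,
      hh]
    refine ⟨C (P.rep 1) * (C (∏ P ∈ S, (P.rep 1 * c - P.rep 0)) * X (Sum.inl 1) ^ S.card) +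
      rename Sum.inl (pointForm P) * h, ?_⟩
    simp only [pointForm, map_sub, map_mul, rename_C, rename_X]
    ring

theorem eval_prod_pointForm (c : k) (S : Finset (Pt k 1)) :
    eval ![c, 1] (∏ P ∈ S, pointForm P) = ∏ P ∈ S, (P.rep 1 * c - P.rep 0) := by
  simp [pointForm, map_prod]

/-- The ideal of polynomials vanishing over a point of `ℙⁿ`. -/
def overIdeal (Q : Pt k n) : Ideal (MvPolynomial (Fin (1 + 1) ⊕ Fin (n + 1)) k) :=
  ⨅ (x : Fin (1 + 1) → k) (t : k), RingHom.ker (eval (Sum.elim x (t • Q.rep)))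

theorem mem_overIdeal_iff {Q : Pt k n} {f : MvPolynomial (Fin (1 + 1) ⊕ Fin (n + 1)) k} :
    f ∈ overIdeal Q ↔ ∀ (x : Fin (1 + 1) → k) (t : k), eval (Sum.elim x (t • Q.rep)) f = 0 := by
  simp only [overIdeal, Ideal.mem_iInf, RingHom.mem_ker]

theorem C_mul_mem_iff {σ : Type*} {J : Ideal (MvPolynomial σ k)} {c : k} (hc : c ≠ 0)
    {f : MvPolynomial σ k} : C c * f ∈ J ↔ f ∈ J := by
  refine ⟨fun h => ?_, J.mul_mem_left _⟩
  have := J.mul_mem_left (C c⁻¹) h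
  rwa [← mul_assoc, ← C_mul, inv_mul_cancel₀ hc, C_1, one_mul] at this

theorem exists_minor_ne_zero {Q Q' : Pt k n} (h : Q ≠ Q') :
    ∃ i j, Q.rep i * Q'.rep j - Q.rep j * Q'.rep i ≠ 0 := by
  by_contra! h0
  apply h
  obtain ⟨j, hj⟩ := Function.ne_iff.1 Q'.rep_nonzero
  rw [Pi.zero_apply] at hj
  rw [← Q.mk_rep, ← Q'.mk_rep, Projectivization.mk_eq_mk_iff']
  refine ⟨Q.rep j / Q'.rep j, ?_⟩
  ext i
  simp only [Pi.smul_apply, smul_eq_mul]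
  field_simp
  linear_combination -h0 i j

theorem X_inr_mem_of_overIdeal_le {Q Q' : Pt k n} (h : Q ≠ Q')
    {J : Ideal (MvPolynomial (Fin (1 + 1) ⊕ Fin (n + 1)) k)}
    (hQ : overIdeal Q ≤ J) (hQ' : overIdeal Q' ≤ J) (l : Fin (n + 1)) : X (Sum.inr l) ∈ J := by
  have hm (Q : Pt k n) (i j : Fin (n + 1)) :
      C (Q.rep i) * X (Sum.inr j) - C (Q.rep j) * X (Sum.inr i) ∈ overIdeal Q := by
    rw [mem_overIdeal_iff]
    intro x t
    simp only [map_sub, map_mul, eval_C, eval_X, Sum.elim_inr, Pi.smul_apply, smul_eq_mul]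
    ring
  obtain ⟨i, j, hij⟩ := exists_minor_ne_zero h
  have hi : X (Sum.inr i) ∈ J := by
    rw [← C_mul_mem_iff hij]
    convert J.sub_mem (J.mul_mem_left (C (Q'.rep i)) (hQ (hm Q i j)))
      (J.mul_mem_left (C (Q.rep i)) (hQ' (hm Q' i j))) using 1
    simp only [map_sub, map_mul]
    ring
  have hj : X (Sum.inr j) ∈ J := by
    rw [← C_mul_mem_iff hij]
    convert J.sub_mem (J.mul_mem_left (C (Q'.rep j)) (hQ (hm Q i j)))
      (J.mul_mem_left (C (Q.rep j)) (hQ' (hm Q' i j))) using 1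
    simp only [map_sub, map_mul]
    ring
  have key (m : Fin (n + 1)) (hm0 : Q.rep m ≠ 0) (hmJ : X (Sum.inr m) ∈ J) :
      X (Sum.inr l) ∈ J := by
    rw [← C_mul_mem_iff hm0]
    convert J.add_mem (hQ (hm Q m l)) (J.mul_mem_left (C (Q.rep l)) hmJ) using 1
    ring
  by_cases h0 : Q.rep i = 0
  · exact key j (fun h1 => hij (by simp [h0, h1])) hj
  · exact key i h0 hi

theorem X_mem_radical_colon (hZ : Z.Finite) {c : k}
    (hc : ∀ p ∈ Z, p.1.rep 1 * c - p.1.rep 0 ≠ 0) {m b : ℕ} {e : MvPolynomial (Fin (n + 1)) k}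
    (he : e.IsHomogeneous b) (hv : ∀ p ∈ Z, m < (fiber hZ p.2).card → eval p.2.rep e = 0)
    (v : Fin (1 + 1) ⊕ Fin (n + 1)) :
    X v ∈ ((vanishP2 k Z ⊔ Ideal.span {X (Sum.inl 0) - C c * X (Sum.inl 1)}).colon
      {X (Sum.inl 1) ^ m * rename Sum.inr e}).radical := by
  classical
  set L : MvPolynomial (Fin (1 + 1) ⊕ Fin (n + 1)) k := X (Sum.inl 0) - C c * X (Sum.inl 1) with hLdef
  set u : MvPolynomial (Fin (1 + 1) ⊕ Fin (n + 1)) k :=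
    X (Sum.inl 1) ^ m * rename Sum.inr e with hu
  set J := vanishP2 k Z ⊔ Ideal.span {L} with hJ
  have hIJ : vanishP2 k Z ≤ J := le_sup_left
  have hLJ : L ∈ J := le_sup_right (a := vanishP2 k Z) (Ideal.mem_span_singleton_self L)
  have hJK : J ≤ J.colon {u} := fun g hg => by
    rw [Submodule.mem_colon_singleton, smul_eq_mul]
    exact J.mul_mem_right _ hg
  rw [Ideal.radical_eq_sInf, Submodule.mem_sInf]
  rintro 𝔭 ⟨hK, hp⟩
  have hI𝔭 : vanishP2 k Z ≤ 𝔭 := hIJ.trans (hJK.trans hK)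
  have hL𝔭 : L ∈ 𝔭 := hK (hJK hLJ)
  have hκ (S : Finset (Pt k 1)) (hS : ∀ P ∈ S, ∃ Q, (P, Q) ∈ Z) :
      ∏ P ∈ S, (P.rep 1 * c - P.rep 0) ≠ 0 := by
    rw [Finset.prod_ne_zero_iff]
    intro P hP
    obtain ⟨Q, hQ⟩ := hS P hP
    exact hc _ hQ
  rcases v with i | j
  · have hx1 : X (Sum.inl 1) ∈ 𝔭 := by
      obtain ⟨h, hh⟩ := exists_rename_prod_pointForm_eq (n := n) c (hZ.image Prod.fst).toFinset
      have h1 : rename Sum.inl (∏ P ∈ (hZ.image Prod.fst).toFinset, pointForm P) ∈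
          vanishP2 k Z := by
        rw [mem_vanishP2_iff]
        intro p hp s t
        rw [eval_rename, Sum.elim_comp_inl, map_prod]
        refine Finset.prod_eq_zero (i := p.1) ?_ (eval_smul_pointForm _ _)
        simpa using ⟨p.2, hp⟩
      rw [hh] at h1
      have h2 := (Ideal.add_mem_iff_left 𝔭 (Ideal.mul_mem_right h 𝔭 hL𝔭)).1 (hI𝔭 h1)
      rw [C_mul_mem_iff (hκ _ fun P hP => by simpa using hP)] at h2
      exact hp.mem_of_pow_mem _ h2
    fin_cases i
    · have := 𝔭.add_mem hL𝔭 (Ideal.mul_mem_left 𝔭 (C c) hx1)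
      rwa [hLdef, sub_add_cancel] at this
    · exact hx1
  · set D := (hZ.image Prod.snd).toFinset with hD
    have hmemD {p : Pt k 1 × Pt k n} (hp : p ∈ Z) : p.2 ∈ D := by
      simpa [hD] using ⟨p.1, hp⟩
    have hprod (s : Finset (Pt k n)) (hs : s.inf overIdeal ≤ 𝔭) : ∃ Q ∈ s, overIdeal Q ≤ 𝔭 :=
      hp.prod_le.1 (Ideal.prod_le_inf.trans hs)
    have hzero {s : Finset (Pt k n)} {g : MvPolynomial (Fin (1 + 1) ⊕ Fin (n + 1)) k}
        (hg : g ∈ s.inf overIdeal) {Q : Pt k n} (hQ : Q ∈ s) (x : Fin (1 + 1) → k) (t : k) :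
        eval (Sum.elim x (t • Q.rep)) g = 0 :=
      mem_overIdeal_iff.1 ((Finset.inf_le (f := overIdeal) hQ : s.inf overIdeal ≤ overIdeal Q) hg) x t
    obtain ⟨Q, hQD, hQ⟩ := hprod D fun g hg => hI𝔭 <| by
      rw [mem_vanishP2_iff]
      exact fun p hp s t => hzero hg (hmemD hp) _ _
    by_cases hQm : (fiber hZ Q).card ≤ m
    · obtain ⟨Q', hQ'D, hQ'⟩ := hprod (D.erase Q) fun g hg => hK <| by
        rw [Submodule.mem_colon_singleton, smul_eq_mul]
        obtain ⟨h, hh⟩ := exists_rename_prod_pointForm_eq (n := n) c (fiber hZ Q)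
        rw [← C_mul_mem_iff (hκ (fiber hZ Q) fun P hP => ⟨Q, mem_fiber.1 hP⟩)]
        have h1 : rename Sum.inl (∏ P ∈ fiber hZ Q, pointForm P) * g ∈ vanishP2 k Z := by
          rw [mem_vanishP2_iff]
          intro p hp s t
          rw [map_mul]
          by_cases hpQ : p.2 = Q
          · rw [eval_rename, Sum.elim_comp_inl, map_prod,
              Finset.prod_eq_zero (i := p.1) (mem_fiber.2 (hpQ ▸ hp)) (eval_smul_pointForm _ _),
              zero_mul]
          · rw [hzero hg (Finset.mem_erase.2 ⟨hpQ, hmemD hp⟩), mul_zero]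
        rw [hh] at h1
        have hpow : (X (Sum.inl 1) ^ m : MvPolynomial (Fin (1 + 1) ⊕ Fin (n + 1)) k) =
            X (Sum.inl 1) ^ (fiber hZ Q).card * X (Sum.inl 1) ^ (m - (fiber hZ Q).card) := by
          rw [← pow_add, Nat.add_sub_cancel' hQm]
        convert J.sub_mem
          (J.mul_mem_left (X (Sum.inl 1) ^ (m - (fiber hZ Q).card) * rename Sum.inr e) (hIJ h1))
          (J.mul_mem_left (X (Sum.inl 1) ^ (m - (fiber hZ Q).card) * rename Sum.inr e * h * g) hLJ)
          using 1
        rw [hu, hpow]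
        ring
      exact X_inr_mem_of_overIdeal_le (Finset.ne_of_mem_erase hQ'D) hQ' hQ j
    · obtain ⟨Q', hQ'D, hQ'⟩ := hprod (D.filter fun Q => (fiber hZ Q).card ≤ m) fun g hg => hK <| by
        rw [Submodule.mem_colon_singleton, smul_eq_mul]
        refine hIJ (mem_vanishP2_iff.2 fun p hp s t => ?_)
        by_cases hpm : (fiber hZ p.2).card ≤ m
        · rw [map_mul, hzero hg (Finset.mem_filter.2 ⟨hmemD hp, hpm⟩), zero_mul]
        · rw [hu, map_mul, map_mul, eval_rename, Sum.elim_comp_inr, eval_smul_of_isHomogeneous he,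
            hv p hp (not_le.1 hpm)]
          ring
      exact X_inr_mem_of_overIdeal_le
        (by rintro rfl; exact hQm (Finset.mem_filter.1 hQ'D).2) hQ' hQ j

theorem exists_lift [Infinite k] (hZ : Z.Finite) (hACM : IsACM (vanishP2 k Z)) {c : k}
    (hc : ∀ p ∈ Z, p.1.rep 1 * c - p.1.rep 0 ≠ 0) {m b : ℕ} {e : MvPolynomial (Fin (n + 1)) k}
    (he : e.IsHomogeneous b) (hv : ∀ p ∈ Z, m < (fiber hZ p.2).card → eval p.2.rep e = 0) :
    ∃ f ∈ vanishP2 k Z, f.IsWeightedHomogeneous bidegree (m, b) ∧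
      ∀ y, eval (Sum.elim ![c, 1] y) f = eval y e := by
  classical
  set L : MvPolynomial (Fin (1 + 1) ⊕ Fin (n + 1)) k := X (Sum.inl 0) - C c * X (Sum.inl 1) with hLdef
  set u : MvPolynomial (Fin (1 + 1) ⊕ Fin (n + 1)) k :=
    X (Sum.inl 1) ^ m * rename Sum.inr e with hu
  have huhom : u.IsWeightedHomogeneous bidegree (m, b) := by
    have := ((isWeightedHomogeneous_X k (bidegree (n := n)) (Sum.inl 1)).pow m).mul
      (isWeightedHomogeneous_rename_inr he)
    simpa [bidegree] using this
  obtain ⟨r₁, r₂, hr, hr₁, hr₂⟩ := exists_regular_pair_of_isACM hACM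
  have hpow (r) (hr : r = r₁ ∨ r = r₂) :
      ∃ N : ℕ, Ideal.Quotient.mk (vanishP2 k Z) L ∣ r ^ N * Ideal.Quotient.mk (vanishP2 k Z) u := by
    obtain ⟨ρ, hρ, rfl⟩ := (Ideal.mem_map_iff_of_surjective _ Ideal.Quotient.mk_surjective).1
      (‹∀ r, r = r₁ ∨ r = r₂ → _› r hr)
    have hle : Ideal.span (Set.range MvPolynomial.X) ≤
        ((vanishP2 k Z ⊔ Ideal.span {L}).colon {u}).radical := by
      rw [Ideal.span_le]
      rintro _ ⟨v, rfl⟩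
      exact X_mem_radical_colon hZ hc he hv v
    obtain ⟨N, hN⟩ := hle hρ
    rw [Submodule.mem_colon_singleton, smul_eq_mul, Submodule.mem_sup] at hN
    obtain ⟨i, hi, g, hg, hsum⟩ := hN
    obtain ⟨h, rfl⟩ := Ideal.mem_span_singleton.1 hg
    refine ⟨N, Ideal.Quotient.mk _ h, ?_⟩
    rw [← map_pow, ← map_mul, ← hsum, map_add, Ideal.Quotient.eq_zero_iff_mem.2 hi, zero_add,
      map_mul]
  obtain ⟨M, hM⟩ := hpow r₁ (Or.inl rfl)
  obtain ⟨N, hN⟩ := hpow r₂ (Or.inr rfl)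
  have hL : ∀ x, Ideal.Quotient.mk (vanishP2 k Z) L * x = 0 → x = 0 := by
    intro x hx
    obtain ⟨x, rfl⟩ := Ideal.Quotient.mk_surjective x
    rw [← map_mul, Ideal.Quotient.eq_zero_iff_mem, mem_vanishP2_iff_planeHom] at hx
    rw [Ideal.Quotient.eq_zero_iff_mem, mem_vanishP2_iff_planeHom]
    intro p hp
    have h := hx p hp
    rw [map_mul] at h
    refine (mul_eq_zero.1 h).resolve_left ?_
    have : planeHom p.1.rep p.2.rep L = -(C (p.1.rep 1 * c - p.1.rep 0) * X 0) := by
      simp only [hLdef, planeHom, map_sub, map_mul, aeval_X, aeval_C, Sum.elim_inl, algebraMap_eq]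
      ring
    rw [this, neg_eq_zero]
    exact mul_ne_zero (C_ne_zero.2 (hc p hp)) (X_ne_zero _)
  obtain ⟨h, hh⟩ := dvd_of_dvd_pow_mul hr₁ hr₂ hL hM hN
  obtain ⟨h, rfl⟩ := Ideal.Quotient.mk_surjective h
  rw [← map_mul, Ideal.Quotient.eq] at hh
  refine ⟨_, component_mem_vanishP2 hh (m, b),
    weightedHomogeneousComponent_isWeightedHomogeneous _ _, fun y => ?_⟩
  have hL0 : planeHom ![c, 1] y L = 0 := by
    simp [hLdef, planeHom, algebraMap_eq]
  rw [← coeff_planeHom, map_sub, map_mul _ L h, hL0, zero_mul, sub_zero, coeff_planeHom,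
    weightedHomogeneousComponent_of_mem huhom, if_pos rfl, hu, map_mul, eval_rename,
    Sum.elim_comp_inr]
  simp

/-- Members of the vanishing ideal that factor as a product of linear forms through points of
`ℙ¹` below `Z` and a form in the second group of variables. -/
def splitForms (Z : Set (Pt k 1 × Pt k n)) :
    Set (MvPolynomial (Fin (1 + 1) ⊕ Fin (n + 1)) k) :=
  {F | F ∈ vanishP2 k Z ∧ ∃ (l : List (MvPolynomial (Fin (1 + 1)) k))
    (F'' : MvPolynomial (Fin (n + 1)) k) (b : ℕ),
    F = rename Sum.inl l.prod * rename Sum.inr F'' ∧ F''.IsHomogeneous b ∧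
    ∀ ℓ ∈ l, ℓ.IsHomogeneous 1 ∧ ℓ ≠ 0 ∧
      ∃ p ∈ Z, ∀ s : k, eval (s • p.1.rep) ℓ = 0}

theorem rename_inr_mem_splitForms {F : MvPolynomial (Fin (n + 1)) k} {b : ℕ}
    (hF : F.IsHomogeneous b) (hF0 : ∀ p ∈ Z, eval p.2.rep F = 0) :
    rename Sum.inr F ∈ splitForms Z := by
  refine ⟨?_, [], F, b, by simp, hF, by simp⟩
  rw [mem_vanishP2_iff]
  intro p hp s t
  rw [eval_rename, Sum.elim_comp_inr, eval_smul_of_isHomogeneous hF, hF0 p hp, mul_zero]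

/-- A family of forms of degree `b` dual to a set of points of `ℙⁿ` compatible with the
cardinalities of the fibers. -/
theorem exists_dual_forms (hZ : Z.Finite) (b : ℕ) :
    ∃ (B : Finset (Pt k n)) (E : Pt k n → MvPolynomial (Fin (n + 1)) k),
      (∀ Q, (E Q).IsHomogeneous b) ∧ (∀ Q ∈ B, eval Q.rep (E Q) = 1) ∧
      (∀ Q ∈ B, ∀ Q' ∈ B, Q ≠ Q' → eval Q.rep (E Q') = 0) ∧
      ∀ p ∈ Z, ∀ φ : MvPolynomial (Fin (n + 1)) k, φ.IsHomogeneous b →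
        (∀ Q ∈ B, (fiber hZ p.2).card ≤ (fiber hZ Q).card → eval Q.rep φ = 0) →
        eval p.2.rep φ = 0 := by
  obtain ⟨B, -, e, h1, h0, hcl⟩ := exists_dual_subfamily
    (fun Q : Pt k n => (aeval Q.rep : MvPolynomial (Fin (n + 1)) k →ₐ[k] k).toLinearMap.comp
      (homogeneousSubmodule (Fin (n + 1)) k b).subtype)
    (fun Q => (fiber hZ Q).card) (hZ.image Prod.snd).toFinset
  simp only [LinearMap.comp_apply, Submodule.subtype_apply, AlgHom.toLinearMap_apply] at h1 h0 hcl
  refine ⟨B, fun Q => e Q, fun Q => (e Q).2, h1, h0, fun p hp φ hφ h => ?_⟩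
  exact hcl p.2 (by simpa using ⟨p.1, hp⟩) ⟨φ, hφ⟩ h

theorem sub_sum_mem_span_splitForms (hZ : Z.Finite) {a b : ℕ} {B : Finset (Pt k n)}
    {E : Pt k n → MvPolynomial (Fin (n + 1)) k} (hE : ∀ Q, (E Q).IsHomogeneous b)
    (h1 : ∀ Q ∈ B, eval Q.rep (E Q) = 1)
    (h0 : ∀ Q ∈ B, ∀ Q' ∈ B, Q ≠ Q' → eval Q.rep (E Q') = 0)
    (hcl : ∀ p ∈ Z, ∀ φ : MvPolynomial (Fin (n + 1)) k, φ.IsHomogeneous b →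
      (∀ Q ∈ B, (fiber hZ p.2).card ≤ (fiber hZ Q).card → eval Q.rep φ = 0) →
      eval p.2.rep φ = 0)
    {f : MvPolynomial (Fin (1 + 1) ⊕ Fin (n + 1)) k}
    (hf : f.IsWeightedHomogeneous bidegree (a, b)) :
    f - ∑ Q ∈ B, rename Sum.inl (specHom Q.rep f) * rename Sum.inr (E Q) ∈
      Ideal.span (splitForms Z) := by
  obtain ⟨A, φ, hA, hsum⟩ := exists_eq_sum_of_isWeightedHomogeneous hf
  have hspec (y : Fin (n + 1) → k) :
      specHom y f = ∑ d ∈ f.support, A d * C (eval y (φ d)) := by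
    conv_lhs => rw [hsum]
    simp only [map_sum, map_mul, specHom_rename_inl, specHom_rename_inr]
  have key : f - ∑ Q ∈ B, rename Sum.inl (specHom Q.rep f) * rename Sum.inr (E Q) =
      ∑ d ∈ f.support, rename Sum.inl (A d) *
        rename Sum.inr (φ d - ∑ Q ∈ B, C (eval Q.rep (φ d)) * E Q) := by
    simp only [hspec, map_sum, map_mul, map_sub, rename_C, mul_sub, Finset.sum_sub_distrib,
      Finset.sum_mul, Finset.mul_sum, mul_assoc]
    rw [Finset.sum_comm, ← hsum]
  rw [key]
  refine Ideal.sum_mem _ fun d hd => Ideal.mul_mem_left _ _ (Ideal.subset_span ?_)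
  have hhom : (φ d - ∑ Q ∈ B, C (eval Q.rep (φ d)) * E Q).IsHomogeneous b := by
    refine (hA d hd).2.sub (IsHomogeneous.sum _ _ _ fun Q _ => ?_)
    simpa using (isHomogeneous_C _ _).mul (hE Q)
  refine rename_inr_mem_splitForms hhom fun p hp => hcl p hp _ hhom fun Q hQ _ => ?_
  rw [map_sub, map_sum, Finset.sum_eq_single Q]
  · simp [h1 Q hQ]
  · intro Q' hQ' hne
    simp [h0 Q hQ Q' hQ' hne.symm]
  · exact fun h => absurd hQ h

theorem span_splitForms_le : Ideal.span (splitForms Z) ≤ vanishP2 k Z :=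
  Ideal.span_le.2 fun _ h => h.1

theorem prod_pointForm_ne_zero {c : k} (hc : ∀ p ∈ Z, p.1.rep 1 * c - p.1.rep 0 ≠ 0)
    (hZ : Z.Finite) (Q : Pt k n) : eval ![c, 1] (∏ P ∈ fiber hZ Q, pointForm P) ≠ 0 := by
  rw [eval_prod_pointForm, Finset.prod_ne_zero_iff]
  exact fun P hP => hc _ (mem_fiber.1 hP)

theorem prod_mul_dual_mem_vanishP2 [Infinite k] (hZ : Z.Finite) (hACM : IsACM (vanishP2 k Z)) {c : k}
    (hc : ∀ p ∈ Z, p.1.rep 1 * c - p.1.rep 0 ≠ 0) {b : ℕ} {B : Finset (Pt k n)}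
    {E : Pt k n → MvPolynomial (Fin (n + 1)) k} (hE : ∀ Q, (E Q).IsHomogeneous b)
    (h1 : ∀ Q ∈ B, eval Q.rep (E Q) = 1)
    (h0 : ∀ Q ∈ B, ∀ Q' ∈ B, Q ≠ Q' → eval Q.rep (E Q') = 0)
    (hcl : ∀ p ∈ Z, ∀ φ : MvPolynomial (Fin (n + 1)) k, φ.IsHomogeneous b →
      (∀ Q ∈ B, (fiber hZ p.2).card ≤ (fiber hZ Q).card → eval Q.rep φ = 0) →
      eval p.2.rep φ = 0) {Q : Pt k n} (hQ : Q ∈ B) :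
    rename Sum.inl (∏ P ∈ fiber hZ Q, pointForm P) * rename Sum.inr (E Q) ∈ vanishP2 k Z := by
  classical
  induction hm : (fiber hZ Q).card using Nat.strong_induction_on generalizing Q with
  | _ m ih =>
  obtain ⟨f, hfI, hfhom, hfe⟩ := exists_lift hZ hACM hc (m := m) (hE Q) fun p hp hlt =>
    hcl p hp _ (hE Q) fun Q' hQ' hle => h0 Q' hQ' Q hQ (by rintro rfl; omega)
  have hκ (Q' : Pt k n) (hQ' : m ≤ (fiber hZ Q').card) :
      ∃ κ : k, specHom Q'.rep f = C κ * ∏ P ∈ fiber hZ Q', pointForm P :=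
    exists_eq_C_mul_prod_pointForm _
      (fun h => prod_pointForm_ne_zero hc hZ Q' (by rw [h, map_zero])) hQ'
      (specHom_isHomogeneous hfhom _)
      fun P hP => lineHom_specHom_eq_zero hfI (mem_fiber.1 hP)
  have hval (Q' : Pt k n) : eval ![c, 1] (specHom Q'.rep f) = eval Q'.rep (E Q) := by
    rw [eval_specHom, hfe]
  have hother (Q' : Pt k n) (hQ' : Q' ∈ B.erase Q) :
      rename Sum.inl (specHom Q'.rep f) * rename Sum.inr (E Q') ∈ vanishP2 k Z := by
    obtain ⟨hne, hQ'B⟩ := Finset.mem_erase.1 hQ'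
    by_cases hlt : (fiber hZ Q').card < m
    · obtain ⟨g, hg⟩ := prod_pointForm_dvd (fiber hZ Q') (f := specHom Q'.rep f)
        fun P hP => lineHom_specHom_eq_zero hfI (mem_fiber.1 hP)
      have := (vanishP2 k Z).mul_mem_left (rename Sum.inl g) (ih _ hlt hQ'B rfl)
      rw [hg, map_mul]
      convert this using 1
      ring
    · obtain ⟨κ, hκ⟩ := hκ Q' (not_lt.1 hlt)
      have h := hval Q'
      rw [hκ, map_mul, eval_C, h0 Q' hQ'B Q hQ hne] at h
      rw [hκ, (mul_eq_zero.1 h).resolve_right (prod_pointForm_ne_zero hc hZ Q')]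
      simp
  obtain ⟨κ, hκ⟩ := hκ Q hm.ge
  have hκ0 : κ ≠ 0 := by
    rintro rfl
    have h := hval Q
    rw [hκ, h1 Q hQ] at h
    simp at h
  have hmem := span_splitForms_le (sub_sum_mem_span_splitForms hZ hE h1 h0 hcl hfhom)
  rw [← Finset.add_sum_erase _ _ hQ] at hmem
  have := (vanishP2 k Z).sub_mem ((vanishP2 k Z).sub_mem hfI hmem)
    ((vanishP2 k Z).sum_mem hother)
  rw [sub_sub_cancel, add_sub_cancel_right, hκ, map_mul, rename_C, mul_assoc,
    C_mul_mem_iff hκ0] at this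
  exact this

theorem exists_avoiding [Infinite k] (hZ : Z.Finite) :
    ∃ c : k, ∀ p ∈ Z, p.1.rep 1 * c - p.1.rep 0 ≠ 0 := by
  classical
  obtain ⟨c, hc⟩ := Infinite.exists_notMem_finset
    (hZ.toFinset.image fun p => p.1.rep 0 / p.1.rep 1)
  refine ⟨c, fun p hp h => ?_⟩
  by_cases h1 : p.1.rep 1 = 0
  · have h0 : p.1.rep 0 = 0 := by simpa [h1] using h
    exact p.1.rep_nonzero (by ext i; fin_cases i <;> simp [h0, h1])
  · refine hc (Finset.mem_image.2 ⟨p, by simpa using hp, ?_⟩)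
    field_simp
    linear_combination -h

theorem span_splitForms [Infinite k] (hZ : Z.Finite) (hACM : IsACM (vanishP2 k Z)) :
    Ideal.span (splitForms Z) = vanishP2 k Z := by
  obtain ⟨c, hc⟩ := exists_avoiding hZ
  refine le_antisymm span_splitForms_le fun f hf => ?_
  rw [← finsum_weightedHomogeneousComponent bidegree f]
  refine finsum_induction (· ∈ Ideal.span (splitForms Z)) (Ideal.zero_mem _)
    (fun _ _ => Ideal.add_mem _) fun m => ?_
  obtain ⟨a, b⟩ := m
  have hfI := component_mem_vanishP2 hf (a, b)
  have hfhom := weightedHomogeneousComponent_isWeightedHomogeneous (w := bidegree) (a, b) f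
  generalize weightedHomogeneousComponent bidegree (a, b) f = f at hfI hfhom
  obtain ⟨B, E, hE, h1, h0, hcl⟩ := exists_dual_forms hZ b
  rw [← sub_add_cancel f (∑ Q ∈ B, rename Sum.inl (specHom Q.rep f) * rename Sum.inr (E Q))]
  refine Ideal.add_mem _ (sub_sum_mem_span_splitForms hZ hE h1 h0 hcl hfhom)
    (Ideal.sum_mem _ fun Q hQ => ?_)
  obtain ⟨g, hg⟩ := prod_pointForm_dvd (fiber hZ Q) (f := specHom Q.rep f)
    fun P hP => lineHom_specHom_eq_zero hfI (mem_fiber.1 hP)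
  rw [hg, mul_comm _ g, map_mul, mul_assoc]
  refine Ideal.mul_mem_left _ _ (Ideal.subset_span
    ⟨prod_mul_dual_mem_vanishP2 hZ hACM hc hE h1 h0 hcl hQ,
      (fiber hZ Q).toList.map pointForm, E Q, b, by rw [Finset.prod_map_toList], hE Q, ?_⟩)
  intro ℓ hℓ
  obtain ⟨P, hP, rfl⟩ := List.mem_map.1 hℓ
  rw [Finset.mem_toList, mem_fiber] at hP
  refine ⟨pointForm_isHomogeneous P, fun h => ?_, (P, Q), hP, eval_smul_pointForm P⟩
  have := eval_prod_pointForm c {P}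
  rw [Finset.prod_singleton, Finset.prod_singleton, h, map_zero] at this
  exact hc _ hP this.symm

end Ideal

end Auxiliary

/-- **Lemma (splitting of the generators).** Let `X` be an ACM finite set of points in
`ℙ^1 × ℙ^n`.  Then `I_X ⊆ R = k[x₀,x₁,y₀,…,y_n]` has a set of generators each of which
factors as `F = F′·F″` with `F′` of bidegree `(a,0)` (i.e. `F′ ∈ k[x₀,x₁]`) and `F″` of
bidegree `(0,b)` (i.e. `F″ ∈ k[y₀,…,y_n]`); moreover `F′` is a product of linear forms of
degree `(1,0)`, each of which defines a point of `ℙ^1` over which `X` has a level set. -/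
theorem generators_of_ACM [CharZero k] {n : ℕ} (X : Set (Pt k 1 × Pt k n))
    (hfin : X.Finite) (hACM : IsACM (vanishP2 k X)) :
    ∃ G : Set (MvPolynomial (Fin (1 + 1) ⊕ Fin (n + 1)) k),
      Ideal.span G = vanishP2 k X ∧
      ∀ F ∈ G, ∃ (l : List (MvPolynomial (Fin (1 + 1)) k))
          (F'' : MvPolynomial (Fin (n + 1)) k) (b : ℕ),
        F = MvPolynomial.rename (Sum.inl : Fin (1 + 1) → Fin (1 + 1) ⊕ Fin (n + 1)) l.prod *
              MvPolynomial.rename (Sum.inr : Fin (n + 1) → Fin (1 + 1) ⊕ Fin (n + 1)) F'' ∧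
        F''.IsHomogeneous b ∧
        ∀ ℓ ∈ l, ℓ.IsHomogeneous 1 ∧ ℓ ≠ 0 ∧
          ∃ p ∈ X, ∀ s : k, MvPolynomial.eval (s • p.1.rep) ℓ = 0 := by
  exact ⟨splitForms X, span_splitForms hfin hACM, fun F hF => hF.2⟩

end
end

section
/- Let X ⊆ P^1 × P^n with n ≥ 2 be a finite set of points not having the inclusion property, such that the points of π_1(A_X) and of B_Y = π_1(B_X) are generic in P^n (every subset of π_1(A_X) ∪ B_Y has generic Hilbert function). If N_1(X) ∈ D(X), then X is ACM. -/
noncomputable section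

variable (k : Type) [Field k]

/-- The Hilbert function of the quotient by an ideal `I` of a polynomial ring:
`i ↦ dim_k S_i − dim_k (I ∩ S_i)`. -/
def hilbFn {σ : Type} (I : Ideal (MvPolynomial σ k)) (i : ℕ) : ℕ :=
  Module.finrank k (MvPolynomial.homogeneousSubmodule σ k i) -
  Module.finrank k
    ((Submodule.restrictScalars k I ⊓ MvPolynomial.homogeneousSubmodule σ k i :
      Submodule k (MvPolynomial σ k)))

/-- A set of points of `ℙ^m` has generic Hilbert function:
`H_Z(i) = min (C(i+m,m), #Z)` for all `i`. -/
def GenericHF {m : ℕ} (Z : Set (Pt k m)) : Prop :=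
  ∀ i : ℕ, hilbFn k (vanishP k Z) i = min (Nat.choose (i + m) m) Z.ncard

/-- The image in `ℙ^n` of the level set of `X ⊆ ℙ^1 × ℙ^n` over the point `P ∈ ℙ^1`;
this is the set `Y_i = π₁(X_i)` when `P = P_i` is in the image of the first projection. -/
def levelImage {n : ℕ} (X : Set (Pt k 1 × Pt k n)) (P : Pt k 1) : Set (Pt k n) :=
  {q | (P, q) ∈ X}

/-- `X ⊆ ℙ^1 × ℙ^n` has the *inclusion property*: the images `Y_1, …, Y_t` of its level
sets are totally ordered by inclusion. -/
def InclusionProp {n : ℕ} (X : Set (Pt k 1 × Pt k n)) : Prop :=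
  ∀ P₁ P₂ : Pt k 1,
    levelImage k X P₁ ⊆ levelImage k X P₂ ∨ levelImage k X P₂ ⊆ levelImage k X P₁

/-- `B_Y ⊆ ℙ^n`: the points lying in the image of every level set of `X`,
i.e. `B_Y = ⋂ᵢ Y_i`. -/
def BY {n : ℕ} (X : Set (Pt k 1 × Pt k n)) : Set (Pt k n) :=
  {q | ∀ P ∈ Prod.fst '' X, (P, q) ∈ X}

/-- `B_X`: the points `P × Q` of `X` with `Q ∈ ⋂ᵢ Y_i`. -/
def BX {n : ℕ} (X : Set (Pt k 1 × Pt k n)) : Set (Pt k 1 × Pt k n) :=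
  {p ∈ X | p.2 ∈ BY k X}

/-- `A_X = X \ B_X`. -/
def AX {n : ℕ} (X : Set (Pt k 1 × Pt k n)) : Set (Pt k 1 × Pt k n) :=
  X \ BX k X

/-- `N₀(X) = #π₁(A_X)`. -/
def N0 {n : ℕ} (X : Set (Pt k 1 × Pt k n)) : ℕ := (Prod.snd '' AX k X).ncard

/-- `N₁(X) = #π₁(B_X)`. -/
def N1 {n : ℕ} (X : Set (Pt k 1 × Pt k n)) : ℕ := (Prod.snd '' BX k X).ncard

/-- `𝒟(X) = ⋃_{i ∈ ℤ} {C(N₀(X)+i, n), C(N₀(X)+i, n)+1, …, C(N₀(X)+i+1, n) − N₀(X)}`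
(written with `j = N₀(X) + i`). -/
def DX {n : ℕ} (X : Set (Pt k 1 × Pt k n)) : Set ℕ :=
  {m | ∃ j : ℕ, Nat.choose j n ≤ m ∧ m + N0 k X ≤ Nat.choose (j + 1) n}

namespace ProductPoints

variable {k}

theorem Polynomial.eq_zero_of_eval_eq_zero_of_ne_zero [Infinite k] (p : Polynomial k)
    (h : ∀ s : k, s ≠ 0 → p.eval s = 0) : p = 0 := by
  apply Polynomial.eq_zero_of_infinite_isRoot
  refine Set.Infinite.mono (s := {0}ᶜ) (fun s hs => h s hs) ?_
  exact (Set.finite_singleton 0).infinite_compl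

theorem eval_aeval_polynomial {σ : Type} (v : σ → Polynomial k) (F : MvPolynomial σ k) (r : k) :
    (MvPolynomial.aeval v F).eval r = MvPolynomial.eval (fun i => (v i).eval r) F := by
  induction F using MvPolynomial.induction_on with
  | C a => simp
  | add p q hp hq => simp [hp, hq]
  | mul_X p i hp => simp [hp]

theorem eval_smul_of_isHomogeneous {σ : Type} {f : MvPolynomial σ k} {e : ℕ}
    (hf : f.IsHomogeneous e) (t : k) (w : σ → k) :
    MvPolynomial.eval (t • w) f = t ^ e * MvPolynomial.eval w f := by
  rw [MvPolynomial.eval_eq, MvPolynomial.eval_eq, Finset.mul_sum]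
  refine Finset.sum_congr rfl fun d hd => ?_
  have h : ∑ i ∈ d.support, d i = e := (hf.degree_eq_sum_deg_support hd).symm
  simp only [Pi.smul_apply, smul_eq_mul, mul_pow, Finset.prod_mul_distrib,
    Finset.prod_pow_eq_pow_sum, h]
  ring

theorem eval_homogeneousComponent_eq_zero [Infinite k] {σ : Type} {f : MvPolynomial σ k}
    {w : σ → k} (h : ∀ t : k, t ≠ 0 → MvPolynomial.eval (t • w) f = 0) (e : ℕ) :
    MvPolynomial.eval w (MvPolynomial.homogeneousComponent e f) = 0 := by
  set p : Polynomial k := ∑ e ∈ Finset.range (f.totalDegree + 1),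
    Polynomial.monomial e (MvPolynomial.eval w (MvPolynomial.homogeneousComponent e f)) with hp
  have hp0 : p = 0 := by
    refine Polynomial.eq_zero_of_eval_eq_zero_of_ne_zero p fun t ht => ?_
    rw [← h t ht]
    conv_rhs => rw [← MvPolynomial.sum_homogeneousComponent f]
    rw [hp, Polynomial.eval_finsetSum, map_sum]
    refine Finset.sum_congr rfl fun e _ => ?_
    rw [eval_smul_of_isHomogeneous (MvPolynomial.homogeneousComponent_isHomogeneous e f)]
    simp [mul_comm]
  have hc := congrArg (fun q => Polynomial.coeff q e) hp0
  by_cases he : e < f.totalDegree + 1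
  · simpa [hp, Polynomial.finsetSum_coeff, Polynomial.coeff_monomial, he] using hc
  · rw [MvPolynomial.homogeneousComponent_eq_zero _ _ (by omega), map_zero]

theorem mem_vanishP2 {a b : ℕ} {X : Set (Pt k a × Pt k b)}
    {F : MvPolynomial (Fin (a + 1) ⊕ Fin (b + 1)) k} :
    F ∈ vanishP2 k X ↔ ∀ p ∈ X, ∀ s t : k,
      MvPolynomial.eval (Sum.elim (s • p.1.rep) (t • p.2.rep)) F = 0 := by
  simp [vanishP2, RingHom.mem_ker]

theorem mem_vanishP {m : ℕ} {Z : Set (Pt k m)} {f : MvPolynomial (Fin (m + 1)) k} :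
    f ∈ vanishP k Z ↔ ∀ q ∈ Z, ∀ s : k, MvPolynomial.eval (s • q.rep) f = 0 := by
  simp [vanishP, RingHom.mem_ker]

/-- It suffices to test membership in the ideal of `X` off the zero section of the first cone. -/
theorem mem_vanishP2_of_ne_zero [Infinite k] {a b : ℕ} {X : Set (Pt k a × Pt k b)}
    {F : MvPolynomial (Fin (a + 1) ⊕ Fin (b + 1)) k}
    (h : ∀ p ∈ X, ∀ s t : k, s ≠ 0 →
      MvPolynomial.eval (Sum.elim (s • p.1.rep) (t • p.2.rep)) F = 0) :
    F ∈ vanishP2 k X := by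
  refine mem_vanishP2.2 fun p hp s t => ?_
  let v : Fin (a + 1) ⊕ Fin (b + 1) → Polynomial k :=
    Sum.elim (fun i => Polynomial.X * Polynomial.C (p.1.rep i))
      (fun j => Polynomial.C (t * p.2.rep j))
  have hv : ∀ r : k, (fun i => (v i).eval r) = Sum.elim (r • p.1.rep) (t • p.2.rep) := by
    intro r
    ext (i | j) <;> simp [v, mul_comm r]
  have h0 : MvPolynomial.aeval v F = 0 := by
    refine Polynomial.eq_zero_of_eval_eq_zero_of_ne_zero _ fun r hr => ?_
    rw [eval_aeval_polynomial, hv]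
    exact h p hp r t hr
  rw [← hv, ← eval_aeval_polynomial, h0, Polynomial.eval_zero]

theorem Pt.eq_of_rep_eq_smul {m : ℕ} {P Q : Pt k m} (a : k) (h : P.rep = a • Q.rep) : P = Q := by
  rw [← P.mk_rep, ← Q.mk_rep, Projectivization.mk_eq_mk_iff']
  exact ⟨a, h.symm⟩

/-- The linear form `x₀ - c x₁` in the coordinate ring of `ℙ¹ × ℙⁿ`. -/
def linForm (n : ℕ) (c : k) : MvPolynomial (Fin (1 + 1) ⊕ Fin (n + 1)) k :=
  MvPolynomial.X (Sum.inl 0) - MvPolynomial.C c * MvPolynomial.X (Sum.inl 1)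

/-- The value at `P` of the affine coordinate `x₁ / (x₀ - c x₁)` of `ℙ¹`. -/
def coord (c : k) (P : Pt k 1) : k := P.rep 1 / (P.rep 0 - c * P.rep 1)

theorem coord_injOn (c : k) :
    Set.InjOn (coord c) {P : Pt k 1 | P.rep 0 - c * P.rep 1 ≠ 0} := by
  intro P hP Q hQ h
  simp only [Set.mem_ofPred_eq] at hP hQ
  apply Pt.eq_of_rep_eq_smul ((P.rep 0 - c * P.rep 1) / (Q.rep 0 - c * Q.rep 1))
  unfold coord at h
  rw [div_eq_div_iff hP hQ] at h
  ext i
  fin_cases i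
  · simp only [Pi.smul_apply, smul_eq_mul, Fin.zero_eta]
    rw [div_mul_eq_mul_div, eq_div_iff hQ]
    linear_combination c * h
  · simp only [Pi.smul_apply, smul_eq_mul, Fin.mk_one]
    rw [div_mul_eq_mul_div, eq_div_iff hQ]
    linear_combination h

/-- Substitution `x₀ = c T`, `x₁ = T`, i.e. restriction to the line `x₀ = c x₁`. -/
def restrict (n : ℕ) (c : k) : MvPolynomial (Fin (1 + 1) ⊕ Fin (n + 1)) k →ₐ[k]
    Polynomial (MvPolynomial (Fin (n + 1)) k) :=
  MvPolynomial.aeval (Sum.elim ![Polynomial.C (MvPolynomial.C c) * Polynomial.X, Polynomial.X]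
    (fun j => Polynomial.C (MvPolynomial.X j)))

/-- Substitution `x₀ = (c u + 1) T`, `x₁ = u T`, `y = w`. -/
def pencil {n : ℕ} (c : k) (w : Fin (n + 1) → k) :
    MvPolynomial (Fin (1 + 1) ⊕ Fin (n + 1)) k →ₐ[k] Polynomial (Polynomial k) :=
  MvPolynomial.aeval (Sum.elim
    ![Polynomial.C (Polynomial.C c * Polynomial.X + 1) * Polynomial.X,
      Polynomial.C Polynomial.X * Polynomial.X]
    (fun j => Polynomial.C (Polynomial.C (w j))))

theorem natDegree_coeff_pencil_le_and {n : ℕ} (c : k) (w : Fin (n + 1) → k)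
    (F : MvPolynomial (Fin (1 + 1) ⊕ Fin (n + 1)) k) : ∀ i : ℕ,
    ((pencil c w F).coeff i).natDegree ≤ i ∧
      ((pencil c w F).coeff i).coeff i = MvPolynomial.eval w ((restrict n c F).coeff i) := by
  induction F using MvPolynomial.induction_on with
  | C a =>
    intro i
    have h1 : pencil c w (MvPolynomial.C a) = Polynomial.C (Polynomial.C a) := by
      simp [pencil, Polynomial.algebraMap_apply]
    have h2 : restrict n c (MvPolynomial.C a) = Polynomial.C (MvPolynomial.C a) := by
      simp [restrict, Polynomial.algebraMap_apply, MvPolynomial.algebraMap_eq]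
    rw [h1, h2]
    rcases i with _ | i <;> simp [Polynomial.coeff_C]
  | add p q hp hq =>
    intro i
    simp only [map_add, Polynomial.coeff_add]
    exact ⟨(Polynomial.natDegree_add_le _ _).trans (max_le (hp i).1 (hq i).1),
      by rw [(hp i).2, (hq i).2]⟩
  | mul_X p j hp =>
    intro i
    have key : ∀ (l : Polynomial k) (a : k), l.natDegree ≤ 1 → l.coeff 1 = a →
        ((pencil c w p * (Polynomial.C l * Polynomial.X)).coeff i).natDegree ≤ i ∧
        ((pencil c w p * (Polynomial.C l * Polynomial.X)).coeff i).coeff i =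
          MvPolynomial.eval w ((restrict n c p * (Polynomial.C (MvPolynomial.C a) *
            Polynomial.X)).coeff i) := by
      intro l a hl ha
      rw [← mul_assoc, ← mul_assoc]
      rcases i with _ | i
      · simp
      · rw [Polynomial.coeff_mul_X, Polynomial.coeff_mul_X, Polynomial.coeff_mul_C,
          Polynomial.coeff_mul_C]
        refine ⟨Polynomial.natDegree_mul_le.trans (add_le_add (hp i).1 hl), ?_⟩
        rw [Polynomial.coeff_mul_add_eq_of_natDegree_le (hp i).1 hl, (hp i).2, ha]
        simp
    rcases j with j | j
    · fin_cases j
      · have := key (Polynomial.C c * Polynomial.X + 1) c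
          (by compute_degree) (by simp [Polynomial.coeff_one])
        simpa [pencil, restrict] using this
      · have := key Polynomial.X 1 (by simp) (by simp)
        simpa [pencil, restrict] using this
    · have h1 : pencil c w (MvPolynomial.X (Sum.inr j)) = Polynomial.C (Polynomial.C (w j)) := by
        simp [pencil]
      have h2 : restrict n c (MvPolynomial.X (Sum.inr j)) = Polynomial.C (MvPolynomial.X j) := by
        simp [restrict]
      rw [map_mul, map_mul, h1, h2, Polynomial.coeff_mul_C, Polynomial.coeff_mul_C,
        Polynomial.coeff_mul_C]
      refine ⟨(Polynomial.natDegree_mul_C_le _ _).trans (hp i).1, ?_⟩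
      rw [(hp i).2]
      simp

theorem eval_pencil {n : ℕ} (c : k) (w : Fin (n + 1) → k)
    (F : MvPolynomial (Fin (1 + 1) ⊕ Fin (n + 1)) k) (u r : k) :
    ((pencil c w F).map (Polynomial.evalRingHom u)).eval r =
      MvPolynomial.eval (Sum.elim ![(c * u + 1) * r, u * r] w) F := by
  induction F using MvPolynomial.induction_on with
  | C a => simp [Polynomial.algebraMap_apply]
  | add p q hp hq => simp [hp, hq]
  | mul_X p j hp =>
    rw [map_mul, map_mul, Polynomial.map_mul, Polynomial.eval_mul, hp]
    congr 1
    rcases j with j | j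
    · fin_cases j <;> simp [pencil]
    · simp [pencil]

theorem eval_coeff_restrict_eq_zero [Infinite k] {n : ℕ} {X : Set (Pt k 1 × Pt k n)}
    (hX : X.Finite) {c : k} (hc : ∀ p ∈ X, p.1.rep 0 - c * p.1.rep 1 ≠ 0)
    {F : MvPolynomial (Fin (1 + 1) ⊕ Fin (n + 1)) k} (hF : F ∈ vanishP2 k X) {i : ℕ}
    {Q : Pt k n} (hi : i < {P | (P, Q) ∈ X}.ncard) (t : k) :
    MvPolynomial.eval (t • Q.rep) ((restrict n c F).coeff i) = 0 := by
  obtain ⟨hdeg, hcoeff⟩ := natDegree_coeff_pencil_le_and c (t • Q.rep) F i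
  have hS : {P | (P, Q) ∈ X}.Finite :=
    hX.preimage (Function.Injective.injOn fun _ _ h => (Prod.mk.inj h).1)
  classical
  suffices h : (pencil c (t • Q.rep) F).coeff i = 0 by rw [← hcoeff, h, Polynomial.coeff_zero]
  apply Polynomial.eq_zero_of_natDegree_lt_card_of_eval_eq_zero' _ (hS.toFinset.image (coord c))
  · intro u hu
    obtain ⟨P, hP, rfl⟩ := Finset.mem_image.1 hu
    have hP : (P, Q) ∈ X := by simpa using hP
    have hP0 := hc _ hP
    have hmap : (pencil c (t • Q.rep) F).map (Polynomial.evalRingHom (coord c P)) = 0 := by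
      refine Polynomial.eq_zero_of_eval_eq_zero_of_ne_zero _ fun r _ => ?_
      rw [eval_pencil, ← mem_vanishP2.1 hF _ hP (r / (P.rep 0 - c * P.rep 1)) t]
      congr 3
      funext j
      match j with
      | 0 =>
        simp [coord]
        field_simp
        ring
      | 1 =>
        simp [coord]
        field_simp
    have := congrArg (fun q => Polynomial.coeff q i) hmap
    simpa using this
  · rw [Finset.card_image_of_injOn, ← Set.ncard_eq_toFinset_card _ hS]
    · omega
    · refine (coord_injOn c).mono fun P hP => ?_
      have hP : (P, Q) ∈ X := by simpa using hP
      exact hc _ hP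

theorem restrict_linForm (n : ℕ) (c : k) : restrict n c (linForm n c) = 0 := by
  simp [restrict, linForm, Polynomial.algebraMap_apply, MvPolynomial.algebraMap_eq]

theorem sub_sum_coeff_restrict_mem {n : ℕ} (c : k)
    (F : MvPolynomial (Fin (1 + 1) ⊕ Fin (n + 1)) k) :
    F - ∑ i ∈ Finset.range ((restrict n c F).natDegree + 1),
      MvPolynomial.rename Sum.inr ((restrict n c F).coeff i) * MvPolynomial.X (Sum.inl 1) ^ i ∈
      Ideal.span {linForm n c} := by
  have h : ∀ F : MvPolynomial (Fin (1 + 1) ⊕ Fin (n + 1)) k,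
      F - Polynomial.eval₂ ((MvPolynomial.rename Sum.inr : MvPolynomial (Fin (n + 1)) k →ₐ[k]
        MvPolynomial (Fin (1 + 1) ⊕ Fin (n + 1)) k) : _ →+* _)
        (MvPolynomial.X (Sum.inl 1)) (restrict n c F) ∈ Ideal.span {linForm n c} := by
    intro F
    rw [← Ideal.Quotient.eq]
    induction F using MvPolynomial.induction_on with
    | C a => simp [restrict, Polynomial.algebraMap_apply, MvPolynomial.algebraMap_eq]
    | add p q hp hq => simp only [map_add, Polynomial.eval₂_add, ← hp, ← hq]
    | mul_X p j hp =>
      rw [map_mul, map_mul, Polynomial.eval₂_mul, map_mul, ← hp]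
      congr 1
      rcases j with j | j
      · fin_cases j
        · rw [Ideal.Quotient.eq]
          simp [restrict, linForm]
        · simp [restrict]
      · simp [restrict]
  have := h F
  rwa [Polynomial.eval₂_eq_sum_range] at this

/-- The form of degree `i` in `x₀, x₁` congruent to `x₁ ^ i` modulo `x₀ - c x₁` and vanishing on
the points of `T`. -/
def fiberForm (n : ℕ) (c : k) (T : Finset (Pt k 1)) (i : ℕ) :
    MvPolynomial (Fin (1 + 1) ⊕ Fin (n + 1)) k :=
  MvPolynomial.X (Sum.inl 1) ^ (i - T.card) *
    ∏ P ∈ T, (MvPolynomial.X (Sum.inl 1) - MvPolynomial.C (coord c P) * linForm n c)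

theorem fiberForm_sub_mem {n : ℕ} (c : k) {T : Finset (Pt k 1)} {i : ℕ} (hT : T.card ≤ i) :
    fiberForm n c T i - MvPolynomial.X (Sum.inl 1) ^ i ∈ Ideal.span {linForm n c} := by
  have h0 : Ideal.Quotient.mk (Ideal.span {linForm n c}) (linForm n c) = 0 :=
    Ideal.Quotient.eq_zero_iff_mem.2 (Ideal.mem_span_singleton_self _)
  rw [← Ideal.Quotient.eq]
  simp [fiberForm, h0, ← pow_add, Nat.sub_add_cancel hT]

theorem eval_fiberForm {n : ℕ} {c : k} {T : Finset (Pt k 1)} {P : Pt k 1} (hP : P ∈ T)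
    (hc : P.rep 0 - c * P.rep 1 ≠ 0) (i : ℕ) (s : k) (w : Fin (n + 1) → k) :
    MvPolynomial.eval (Sum.elim (s • P.rep) w) (fiberForm n c T i) = 0 := by
  rw [fiberForm, map_mul, map_prod, Finset.prod_eq_zero hP, mul_zero]
  have h : coord c P * (P.rep 0 - c * P.rep 1) = P.rep 1 := div_mul_cancel₀ _ hc
  simp only [linForm, map_sub, map_mul, MvPolynomial.eval_X, MvPolynomial.eval_C, Sum.elim_inl,
    Pi.smul_apply, smul_eq_mul]
  linear_combination (-s) * h

theorem finrank_homogeneousSubmodule (m e : ℕ) :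
    Module.finrank k (MvPolynomial.homogeneousSubmodule (Fin (m + 1)) k e) =
      Nat.choose (e + m) m := by
  rw [MvPolynomial.homogeneousSubmodule_eq_finsupp_supported,
    (AddMonoidAlgebra.supportedEquivFinsupp _).finrank_eq]
  have hS : {d : Fin (m + 1) →₀ ℕ | d.degree = e} =
      ((Finset.univ : Finset (Fin (m + 1))).finsuppAntidiag e : Set (Fin (m + 1) →₀ ℕ)) := by
    ext d
    simp [Finsupp.degree_eq_sum]
  rw [hS, Module.finrank_finsupp_self, ← Set.toFinset_card, Finset.toFinset_coe,
    Finset.card_finsuppAntidiag_nat_eq_choose,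
    Finset.card_univ, Fintype.card_fin]
  rw [show m + 1 + e - 1 = e + m by omega, ← Nat.choose_symm_add, Nat.add_comm]

instance (m e : ℕ) : Module.Finite k (MvPolynomial.homogeneousSubmodule (Fin (m + 1)) k e) :=
  Module.Finite.iff_fg.2 (MvPolynomial.homogeneousSubmodule_fg _ _ e)

theorem mem_vanishP_of_isHomogeneous {m e : ℕ} {Z : Set (Pt k m)}
    {f : MvPolynomial (Fin (m + 1)) k} (hf : f.IsHomogeneous e)
    (h : ∀ Q ∈ Z, MvPolynomial.eval Q.rep f = 0) : f ∈ vanishP k Z :=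
  mem_vanishP.2 fun Q hQ s => by rw [eval_smul_of_isHomogeneous hf, h Q hQ, mul_zero]

/-- If `Z` imposes the maximal number of conditions on forms of degree `e`, no nonzero form of
degree `e` vanishes on `Z`. -/
theorem eq_zero_of_hilbFn_eq_choose {m e : ℕ} {Z : Set (Pt k m)}
    (h : hilbFn k (vanishP k Z) e = Nat.choose (e + m) m) {f : MvPolynomial (Fin (m + 1)) k}
    (hf : f.IsHomogeneous e) (h0 : ∀ Q ∈ Z, MvPolynomial.eval Q.rep f = 0) : f = 0 := by
  have hpos : 0 < Nat.choose (e + m) m := Nat.choose_pos (by omega)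
  rw [hilbFn, finrank_homogeneousSubmodule] at h
  set W : Submodule k (MvPolynomial (Fin (m + 1)) k) :=
    Submodule.restrictScalars k (vanishP k Z) ⊓ MvPolynomial.homogeneousSubmodule _ k e
  have hfin : Module.Finite k W :=
    Submodule.finiteDimensional_of_le (inf_le_right :
      W ≤ MvPolynomial.homogeneousSubmodule (Fin (m + 1)) k e)
  have hW : W = ⊥ := Submodule.finrank_eq_zero.1 (by omega)
  have hmem : f ∈ W := ⟨mem_vanishP_of_isHomogeneous hf h0, hf⟩
  rwa [hW, Submodule.mem_bot] at hmem

/-- If `Z` imposes independent conditions on forms of degree `e`, such forms separate `Z`. -/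
theorem exists_isHomogeneous_eval_eq {m e : ℕ} {Z : Set (Pt k m)} (hZ : Z.Finite)
    (h : hilbFn k (vanishP k Z) e = Z.ncard) (v : Pt k m → k) :
    ∃ g : MvPolynomial (Fin (m + 1)) k, g.IsHomogeneous e ∧
      ∀ Q ∈ Z, MvPolynomial.eval Q.rep g = v Q := by
  have := hZ.fintype
  let ev : MvPolynomial.homogeneousSubmodule (Fin (m + 1)) k e →ₗ[k] (Z → k) :=
    LinearMap.pi fun Q => (MvPolynomial.aeval (Q : Pt k m).rep).toLinearMap ∘ₗ Submodule.subtype _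
  have hev : ∀ f Q, ev f Q = MvPolynomial.eval (Q : Pt k m).rep (f : MvPolynomial _ k) := by
    intro f Q
    simp [ev, MvPolynomial.aeval_eq_eval]
  have hker : (LinearMap.ker ev).map (Submodule.subtype _) =
      Submodule.restrictScalars k (vanishP k Z) ⊓ MvPolynomial.homogeneousSubmodule _ k e := by
    ext f
    constructor
    · rintro ⟨f, hf, rfl⟩
      refine ⟨mem_vanishP_of_isHomogeneous f.2 fun Q hQ => ?_, f.2⟩
      rw [Submodule.subtype_apply, ← hev f ⟨Q, hQ⟩, LinearMap.mem_ker.1 hf, Pi.zero_apply]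
    · rintro ⟨hf, hfe⟩
      refine ⟨⟨f, hfe⟩, LinearMap.mem_ker.2 (funext fun Q => ?_), rfl⟩
      rw [hev]
      simpa using mem_vanishP.1 hf Q Q.2 1
  have hrk := LinearMap.finrank_range_add_finrank_ker ev
  rw [hilbFn, ← hker, ← (Submodule.equivSubtypeMap _ (LinearMap.ker ev)).finrank_eq, ← hrk,
    Nat.add_sub_cancel] at h
  have htop : LinearMap.range ev = ⊤ := by
    apply Submodule.eq_top_of_finrank_eq
    rw [h, Module.finrank_fintype_fun_eq_card, Set.ncard_eq_toFinset_card', Set.toFinset_card]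
  obtain ⟨g, hg⟩ := LinearMap.range_eq_top.1 htop fun Q => v Q
  exact ⟨g, g.2, fun Q hQ => by rw [← hev g ⟨Q, hQ⟩, hg]⟩

theorem rename_mul_X_pow_mem {n : ℕ} {X : Set (Pt k 1 × Pt k n)}
    (hX : X.Finite) {c : k} (hc : ∀ p ∈ X, p.1.rep 0 - c * p.1.rep 1 ≠ 0) {e : ℕ}
    (he : (∀ g : MvPolynomial (Fin (n + 1)) k, g.IsHomogeneous e →
        (∀ Q ∈ BY k X, MvPolynomial.eval Q.rep g = 0) → g = 0) ∨
      hilbFn k (vanishP k (Prod.snd '' X)) e = (Prod.snd '' X).ncard)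
    {f : MvPolynomial (Fin (n + 1)) k} (hf : f.IsHomogeneous e) {i : ℕ}
    (h0 : ∀ Q : Pt k n, i < {P | (P, Q) ∈ X}.ncard → MvPolynomial.eval Q.rep f = 0) :
    MvPolynomial.rename Sum.inr f * MvPolynomial.X (Sum.inl 1) ^ i ∈
      vanishP2 k X ⊔ Ideal.span {linForm n c} := by
  have hS : ∀ Q, {P | (P, Q) ∈ X}.Finite := fun Q =>
    hX.preimage (Function.Injective.injOn fun _ _ h => (Prod.mk.inj h).1)
  rcases he with he | he
  · by_cases hi : i < (Prod.fst '' X).ncard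
    · have hf0 : f = 0 := he f hf fun Q hQ => h0 Q
        (hi.trans_le (Set.ncard_le_ncard (fun P hP => hQ P hP) (hS Q)))
      simp [hf0]
    · have hT := fiberForm_sub_mem (n := n) c (T := (hX.image Prod.fst).toFinset) (i := i)
        (by rw [← Set.ncard_eq_toFinset_card _ (hX.image Prod.fst)]; omega)
      set h := fiberForm n c (hX.image Prod.fst).toFinset i with hh
      have hmem : h ∈ vanishP2 k X := mem_vanishP2.2 fun p hp s t =>
        eval_fiberForm (by simpa using ⟨p.2, hp⟩) (hc p hp) i s _
      rw [show MvPolynomial.X (Sum.inl 1) ^ i = h - (h - MvPolynomial.X (Sum.inl 1) ^ i) by ring]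
      exact Ideal.mul_mem_left _ _ (sub_mem (Ideal.mem_sup_left hmem) (Ideal.mem_sup_right hT))
  · classical
    have hY : (Prod.snd '' X).Finite := hX.image _
    choose g hg hgv using fun R : Pt k n =>
      exists_isHomogeneous_eval_eq hY he (fun Q => if Q = R then 1 else 0)
    let H : Pt k n → MvPolynomial (Fin (1 + 1) ⊕ Fin (n + 1)) k := fun Q =>
      fiberForm n c (hS Q).toFinset i
    let G : Pt k n → MvPolynomial (Fin (n + 1)) k := fun Q =>
      MvPolynomial.C (MvPolynomial.eval Q.rep f) * g Q
    have hG : ∀ Q, (G Q).IsHomogeneous e := fun Q => (hg Q).C_mul _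
    have hGH : ∀ Q, MvPolynomial.rename Sum.inr (G Q) * (H Q - MvPolynomial.X (Sum.inl 1) ^ i) ∈
        vanishP2 k X ⊔ Ideal.span {linForm n c} := by
      intro Q
      by_cases hQ : i < {P | (P, Q) ∈ X}.ncard
      · simp [G, h0 Q hQ]
      · refine Ideal.mem_sup_right (Ideal.mul_mem_left _ _ (fiberForm_sub_mem c ?_))
        rw [← Set.ncard_eq_toFinset_card _ (hS Q)]
        omega
    have h1 : ∑ Q ∈ hY.toFinset, MvPolynomial.rename Sum.inr (G Q) * H Q ∈ vanishP2 k X := by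
      refine mem_vanishP2.2 fun p hp s t => ?_
      rw [map_sum]
      refine Finset.sum_eq_zero fun Q _ => ?_
      rw [map_mul, MvPolynomial.eval_rename, Sum.elim_comp_inr, eval_smul_of_isHomogeneous (hG Q)]
      by_cases hQ : p.2 = Q
      · rw [eval_fiberForm (by simpa [← hQ] using hp) (hc p hp), mul_zero]
      · simp [G, hgv Q p.2 ⟨p, hp, rfl⟩, hQ]
    have h2 : MvPolynomial.rename Sum.inr (f - ∑ Q ∈ hY.toFinset, G Q) ∈ vanishP2 k X := by
      refine mem_vanishP2.2 fun p hp s t => ?_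
      have hhom : (f - ∑ Q ∈ hY.toFinset, G Q).IsHomogeneous e :=
        hf.sub (MvPolynomial.IsHomogeneous.sum _ _ _ fun Q _ => hG Q)
      have hpY : p.2 ∈ Prod.snd '' X := ⟨p, hp, rfl⟩
      rw [MvPolynomial.eval_rename, Sum.elim_comp_inr, eval_smul_of_isHomogeneous hhom, map_sub,
        map_sum]
      simp only [G, map_mul, MvPolynomial.eval_C, hgv _ p.2 hpY, mul_ite, mul_one, mul_zero]
      rw [Finset.sum_ite_eq, if_pos (hY.mem_toFinset.2 hpY), sub_self, mul_zero]
    have key : MvPolynomial.rename Sum.inr f * MvPolynomial.X (Sum.inl 1) ^ i =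
        MvPolynomial.rename Sum.inr (f - ∑ Q ∈ hY.toFinset, G Q) * MvPolynomial.X (Sum.inl 1) ^ i +
        (∑ Q ∈ hY.toFinset, MvPolynomial.rename Sum.inr (G Q) * H Q -
        ∑ Q ∈ hY.toFinset, MvPolynomial.rename Sum.inr (G Q) *
          (H Q - MvPolynomial.X (Sum.inl 1) ^ i)) := by
      simp only [map_sub, map_sum, mul_sub, sub_mul, Finset.sum_sub_distrib, Finset.sum_mul]
      ring
    rw [key]
    exact add_mem (Ideal.mem_sup_left (Ideal.mul_mem_right _ _ h2))
      (sub_mem (Ideal.mem_sup_left h1) (sum_mem fun Q _ => hGH Q))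

theorem restrict_rename_inr {n : ℕ} (c : k) (f : MvPolynomial (Fin (n + 1)) k) :
    restrict n c (MvPolynomial.rename Sum.inr f) = Polynomial.C f := by
  induction f using MvPolynomial.induction_on with
  | C a => simp [restrict, Polynomial.algebraMap_apply, MvPolynomial.algebraMap_eq]
  | add p q hp hq => rw [map_add, map_add, hp, hq, map_add]
  | mul_X p j hp =>
    rw [map_mul, map_mul, hp, map_mul]
    simp [restrict]

theorem mem_sup_of_mul_mem_sup [Infinite k] {n : ℕ} {X : Set (Pt k 1 × Pt k n)}
    (hX : X.Finite) {c : k} (hc : ∀ p ∈ X, p.1.rep 0 - c * p.1.rep 1 ≠ 0)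
    (he : ∀ e : ℕ, (∀ g : MvPolynomial (Fin (n + 1)) k, g.IsHomogeneous e →
        (∀ Q ∈ BY k X, MvPolynomial.eval Q.rep g = 0) → g = 0) ∨
      hilbFn k (vanishP k (Prod.snd '' X)) e = (Prod.snd '' X).ncard)
    {μ : MvPolynomial (Fin (n + 1)) k} (hμ : μ.IsHomogeneous 1)
    (hμ0 : ∀ p ∈ X, MvPolynomial.eval p.2.rep μ ≠ 0)
    {F : MvPolynomial (Fin (1 + 1) ⊕ Fin (n + 1)) k}
    (hF : MvPolynomial.rename Sum.inr μ * F ∈ vanishP2 k X ⊔ Ideal.span {linForm n c}) :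
    F ∈ vanishP2 k X ⊔ Ideal.span {linForm n c} := by
  have hvan : ∀ (i : ℕ) (Q : Pt k n), i < {P | (P, Q) ∈ X}.ncard → ∀ t : k, t ≠ 0 →
      MvPolynomial.eval (t • Q.rep) ((restrict n c F).coeff i) = 0 := by
    intro i Q hi t ht
    obtain ⟨P, hP⟩ := Set.nonempty_of_ncard_ne_zero (Nat.ne_zero_of_lt hi)
    obtain ⟨a, ha, b, hb, hab⟩ := Submodule.mem_sup.1 hF
    obtain ⟨b, rfl⟩ := Ideal.mem_span_singleton'.1 hb
    have h1 := eval_coeff_restrict_eq_zero hX hc ha hi t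
    have h2 : restrict n c a = Polynomial.C μ * restrict n c F := by
      rw [← restrict_rename_inr, ← map_mul, ← hab]
      simp [restrict_linForm]
    rw [h2, Polynomial.coeff_C_mul, map_mul, eval_smul_of_isHomogeneous hμ, pow_one] at h1
    have hQ : t * MvPolynomial.eval Q.rep μ ≠ 0 := mul_ne_zero ht (hμ0 (P, Q) hP)
    exact (mul_eq_zero.1 h1).resolve_left hQ
  have hrec := sub_sum_coeff_restrict_mem c F
  rw [← sub_add_cancel F (∑ i ∈ Finset.range ((restrict n c F).natDegree + 1),
      MvPolynomial.rename Sum.inr ((restrict n c F).coeff i) * MvPolynomial.X (Sum.inl 1) ^ i)]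
  refine add_mem (Ideal.mem_sup_right hrec) (sum_mem fun i _ => ?_)
  rw [← MvPolynomial.sum_homogeneousComponent ((restrict n c F).coeff i), map_sum, Finset.sum_mul]
  refine sum_mem fun e _ => rename_mul_X_pow_mem hX hc (he e)
    (MvPolynomial.homogeneousComponent_isHomogeneous _ _) fun Q hQ =>
      eval_homogeneousComponent_eq_zero (hvan i Q hQ) e

theorem mem_of_linForm_mul_mem [Infinite k] {n : ℕ} {X : Set (Pt k 1 × Pt k n)}
    {c : k} (hc : ∀ p ∈ X, p.1.rep 0 - c * p.1.rep 1 ≠ 0)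
    {F : MvPolynomial (Fin (1 + 1) ⊕ Fin (n + 1)) k} (hF : linForm n c * F ∈ vanishP2 k X) :
    F ∈ vanishP2 k X := by
  refine mem_vanishP2_of_ne_zero fun p hp s t hs => ?_
  have h := mem_vanishP2.1 hF p hp s t
  rw [map_mul] at h
  refine (mul_eq_zero.1 h).resolve_left ?_
  have : MvPolynomial.eval (Sum.elim (s • p.1.rep) (t • p.2.rep)) (linForm n c) =
      s * (p.1.rep 0 - c * p.1.rep 1) := by
    simp [linForm]
    ring
  rw [this]
  exact mul_ne_zero hs (hc p hp)

/-- Restriction of polynomials to the plane over the point `p`. -/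
def toPlane {n : ℕ} (p : Pt k 1 × Pt k n) :
    MvPolynomial (Fin (1 + 1) ⊕ Fin (n + 1)) k →ₐ[k] MvPolynomial (Fin 2) k :=
  MvPolynomial.aeval (Sum.elim (fun i => MvPolynomial.C (p.1.rep i) * MvPolynomial.X 0)
    (fun j => MvPolynomial.C (p.2.rep j) * MvPolynomial.X 1))

theorem toPlane_surjective {n : ℕ} (p : Pt k 1 × Pt k n) : Function.Surjective (toPlane p) := by
  rw [← AlgHom.range_eq_top, eq_top_iff, ← MvPolynomial.adjoin_range_X, Algebra.adjoin_le_iff]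
  rintro _ ⟨i, rfl⟩
  match i with
  | 0 =>
    obtain ⟨j, hj⟩ := Function.ne_iff.1 p.1.rep_nonzero
    refine ⟨MvPolynomial.C (p.1.rep j)⁻¹ * MvPolynomial.X (Sum.inl j), ?_⟩
    have hj : p.1.rep j ≠ 0 := hj
    simp [toPlane, MvPolynomial.algebraMap_eq, ← mul_assoc, ← MvPolynomial.C_mul, hj]
  | 1 =>
    obtain ⟨j, hj⟩ := Function.ne_iff.1 p.2.rep_nonzero
    refine ⟨MvPolynomial.C (p.2.rep j)⁻¹ * MvPolynomial.X (Sum.inr j), ?_⟩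
    have hj : p.2.rep j ≠ 0 := hj
    simp [toPlane, MvPolynomial.algebraMap_eq, ← mul_assoc, ← MvPolynomial.C_mul, hj]

theorem vanishP2_eq_iInf_ker [Infinite k] {n : ℕ} (X : Set (Pt k 1 × Pt k n)) :
    vanishP2 k X = ⨅ p ∈ X, RingHom.ker (toPlane p) := by
  ext F
  have heval : ∀ (p : Pt k 1 × Pt k n) (v : Fin 2 → k), MvPolynomial.eval v (toPlane p F) =
      MvPolynomial.eval (Sum.elim (v 0 • p.1.rep) (v 1 • p.2.rep)) F := by
    intro p v
    induction F using MvPolynomial.induction_on with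
    | C a => simp [toPlane, MvPolynomial.algebraMap_eq]
    | add p q hp hq => simp [hp, hq]
    | mul_X q j hq =>
      rw [map_mul, map_mul, map_mul, hq]
      congr 1
      rcases j with j | j <;> simp [toPlane, mul_comm]
  simp only [Submodule.mem_iInf, RingHom.mem_ker, mem_vanishP2]
  refine forall₂_congr fun p _ => ⟨fun h => ?_, fun h s t => ?_⟩
  · refine MvPolynomial.funext fun v => ?_
    rw [heval, h, map_zero]
  · have := heval p ![s, t]
    rw [h, map_zero] at this
    simpa using this.symm

theorem ringKrullDim_quotient_ker_toPlane {n : ℕ} (p : Pt k 1 × Pt k n) :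
    ringKrullDim (MvPolynomial (Fin (1 + 1) ⊕ Fin (n + 1)) k ⧸ RingHom.ker (toPlane p)) = 2 := by
  rw [ringKrullDim_eq_of_ringEquiv
    (Ideal.quotientKerAlgEquivOfSurjective (toPlane_surjective p)).toRingEquiv,
    MvPolynomial.ringKrullDim_of_isNoetherianRing, ringKrullDim_eq_zero_of_field]
  simp

theorem ringKrullDim_quotient_vanishP2 [Infinite k] {n : ℕ} {X : Set (Pt k 1 × Pt k n)}
    (hX : X.Finite) (hne : X.Nonempty) :
    ringKrullDim (MvPolynomial (Fin (1 + 1) ⊕ Fin (n + 1)) k ⧸ vanishP2 k X) = 2 := by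
  rw [vanishP2_eq_iInf_ker]
  apply le_antisymm
  · rw [ringKrullDim_quotient]
    refine iSup_le fun l => ?_
    have hhead := l.head.2
    rw [PrimeSpectrum.mem_zeroLocus, SetLike.coe_subset_coe] at hhead
    have : ∃ p ∈ X, RingHom.ker (toPlane p) ≤ l.head.1.asIdeal := by
      have h := (Ideal.IsPrime.inf_le' (s := hX.toFinset) (f := fun p => RingHom.ker (toPlane p))
        l.head.1.isPrime).1 (by simpa [Finset.inf_eq_iInf] using hhead)
      simpa using h
    obtain ⟨p, -, hp⟩ := this
    rw [← ringKrullDim_quotient_ker_toPlane p, ringKrullDim_quotient]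
    let l' : LTSeries (PrimeSpectrum.zeroLocus (RingHom.ker (toPlane p) : Set
        (MvPolynomial (Fin (1 + 1) ⊕ Fin (n + 1)) k))) :=
      { length := l.length
        toFun := fun i => ⟨(l i).1, fun x hx => (l.head_le i : l.head.1 ≤ (l i).1) (hp hx)⟩
        step := fun i => l.step i }
    exact Order.LTSeries.length_le_krullDim l'
  · obtain ⟨p, hp⟩ := hne
    rw [← ringKrullDim_quotient_ker_toPlane p]
    exact ringKrullDim_le_of_surjective _ (Ideal.Quotient.factor_surjective (iInf₂_le p hp))

open scoped Pointwise in
theorem isRegular_pair {A : Type} [CommRing A] {a b : A} (ha : ∀ x, a * x = 0 → x = 0)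
    (hb : ∀ x, b * x ∈ Ideal.span {a} → x ∈ Ideal.span {a}) (hab : Ideal.span {a, b} ≠ ⊤) :
    RingTheory.Sequence.IsRegular A [a, b] := by
  have hsmul : ∀ x : A, x ∈ (a • ⊤ : Submodule A A) ↔ x ∈ Ideal.span {a} := by
    intro x
    rw [Submodule.mem_smul_pointwise_iff_exists, Ideal.mem_span_singleton']
    simp [mul_comm]
  refine ⟨?_, ?_⟩
  · refine RingTheory.Sequence.IsWeaklyRegular.cons ?_
      ((RingTheory.Sequence.isWeaklyRegular_singleton_iff _ b).2 ?_)
    · exact isSMulRegular_iff_right_eq_zero_of_smul.2 ha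
    · refine (isSMulRegular_quotient_iff_mem_of_smul_mem _ _).2 fun x hx => ?_
      exact (hsmul x).2 (hb x ((hsmul _).1 hx))
  · intro h
    apply hab
    rw [Ideal.eq_top_iff_one]
    have h1 : (1 : A) ∈ (Ideal.ofList [a, b] • ⊤ : Submodule A A) := h ▸ Submodule.mem_top
    have hset : {r | r ∈ [a, b]} = ({a, b} : Set A) := by
      ext r
      simp
    rwa [Ideal.ofList, hset, smul_eq_mul, Ideal.mul_top] at h1

theorem span_range_X_eq_ker (σ : Type) :
    Ideal.span (Set.range (MvPolynomial.X : σ → MvPolynomial σ k)) =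
      RingHom.ker (MvPolynomial.constantCoeff : MvPolynomial σ k →+* k) := by
  set m := Ideal.span (Set.range (MvPolynomial.X : σ → MvPolynomial σ k)) with hm
  refine le_antisymm ?_ fun F hF => ?_
  · rw [hm, Ideal.span_le]
    rintro _ ⟨i, rfl⟩
    simp [RingHom.mem_ker]
  · have h : ∀ F : MvPolynomial σ k,
        F - MvPolynomial.C (MvPolynomial.constantCoeff F) ∈ m := by
      intro F
      induction F using MvPolynomial.induction_on with
      | C a => simp
      | add p q hp hq =>
        rw [map_add, map_add, add_sub_add_comm]
        exact add_mem hp hq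
      | mul_X p i hp =>
        rw [map_mul, MvPolynomial.constantCoeff_X, mul_zero, map_zero, sub_zero]
        exact Ideal.mul_mem_left _ _ (Ideal.subset_span ⟨i, rfl⟩)
    have := h F
    rwa [RingHom.mem_ker.1 hF, map_zero, sub_zero] at this

theorem exists_linForm_ne_zero [Infinite k] {n : ℕ} {X : Set (Pt k 1 × Pt k n)} (hX : X.Finite) :
    ∃ c : k, ∀ p ∈ X, p.1.rep 0 - c * p.1.rep 1 ≠ 0 := by
  obtain ⟨c, hc⟩ := (hX.image fun p => p.1.rep 0 / p.1.rep 1).exists_notMem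
  refine ⟨c, fun p hp h => ?_⟩
  by_cases h1 : p.1.rep 1 = 0
  · apply p.1.rep_nonzero
    funext i
    match i with
    | 0 => simpa [h1] using h
    | 1 => exact h1
  · exact hc ⟨p, hp, (div_eq_iff h1).2 (sub_eq_zero.1 h)⟩

theorem exists_isHomogeneous_one_eval_ne_zero [Infinite k] {n : ℕ} {X : Set (Pt k 1 × Pt k n)}
    (hX : X.Finite) : ∃ μ : MvPolynomial (Fin (n + 1)) k, μ.IsHomogeneous 1 ∧
      ∀ p ∈ X, MvPolynomial.eval p.2.rep μ ≠ 0 := by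
  have := hX.to_subtype
  obtain ⟨f, hf⟩ := Module.exists_dual_forall_apply_ne_zero (K := k)
    (fun p : X => (p : Pt k 1 × Pt k n).2.rep) fun p => p.1.2.rep_nonzero
  refine ⟨∑ j, MvPolynomial.C (f (Pi.single j 1)) * MvPolynomial.X j,
    MvPolynomial.IsHomogeneous.sum _ _ _ fun j _ => MvPolynomial.isHomogeneous_C_mul_X _ _,
    fun p hp => ?_⟩
  have h := hf ⟨p, hp⟩
  rw [LinearMap.pi_apply_eq_sum_univ] at h
  have hs : ∀ i : Fin (n + 1), (fun j => if i = j then (1 : k) else 0) = Pi.single i 1 := by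
    intro i
    funext j
    simp [Pi.single_apply, eq_comm]
  simpa [hs, mul_comm] using h

theorem constantCoeff_eq_zero_of_mem_vanishP2 {n : ℕ} {X : Set (Pt k 1 × Pt k n)}
    (hne : X.Nonempty) {F : MvPolynomial (Fin (1 + 1) ⊕ Fin (n + 1)) k}
    (hF : F ∈ vanishP2 k X) : MvPolynomial.constantCoeff F = 0 := by
  obtain ⟨p, hp⟩ := hne
  have h := mem_vanishP2.1 hF p hp 0 0
  rw [zero_smul, zero_smul, show Sum.elim (0 : Fin (1 + 1) → k) (0 : Fin (n + 1) → k) = 0 by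
    ext (i | i) <;> rfl] at h
  rwa [MvPolynomial.eval_zero] at h

/-- A finite nonempty set of points such that each degree `e` either has no nonzero forms
vanishing on the common part of the fibres, or has forms separating the projected points, is
arithmetically Cohen–Macaulay. -/
theorem isACM_vanishP2 [Infinite k] {n : ℕ} {X : Set (Pt k 1 × Pt k n)}
    (hX : X.Finite) (hne : X.Nonempty)
    (he : ∀ e : ℕ, (∀ g : MvPolynomial (Fin (n + 1)) k, g.IsHomogeneous e →
        (∀ Q ∈ BY k X, MvPolynomial.eval Q.rep g = 0) → g = 0) ∨
      hilbFn k (vanishP k (Prod.snd '' X)) e = (Prod.snd '' X).ncard) :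
    IsACM (vanishP2 k X) := by
  obtain ⟨c, hc⟩ := exists_linForm_ne_zero hX
  obtain ⟨μ, hμ, hμ0⟩ := exists_isHomogeneous_one_eval_ne_zero hX
  set I := vanishP2 k X with hI
  set m := Ideal.span (Set.range (MvPolynomial.X :
    Fin (1 + 1) ⊕ Fin (n + 1) → MvPolynomial (Fin (1 + 1) ⊕ Fin (n + 1)) k)) with hm
  have hmker : m = RingHom.ker (MvPolynomial.constantCoeff :
      MvPolynomial (Fin (1 + 1) ⊕ Fin (n + 1)) k →+* k) := span_range_X_eq_ker _
  have hl : linForm n c ∈ m := by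
    rw [hmker, RingHom.mem_ker]
    simp [linForm]
  have hmu : MvPolynomial.rename Sum.inr μ ∈ m := by
    rw [hmker, RingHom.mem_ker, MvPolynomial.constantCoeff_rename,
      MvPolynomial.constantCoeff_eq]
    exact hμ.coeff_eq_zero (by simp)
  have hmem : ∀ x ∈ [Ideal.Quotient.mk I (linForm n c),
      Ideal.Quotient.mk I (MvPolynomial.rename Sum.inr μ)], x ∈ m.map (Ideal.Quotient.mk I) := by
    intro x hx
    rcases List.mem_pair.1 hx with rfl | rfl
    · exact Ideal.mem_map_of_mem _ hl
    · exact Ideal.mem_map_of_mem _ hmu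
  have hspan : ∀ F, Ideal.Quotient.mk I F ∈ Ideal.span {Ideal.Quotient.mk I (linForm n c)} ↔
      F ∈ I ⊔ Ideal.span {linForm n c} := by
    intro F
    rw [← Set.image_singleton, ← Ideal.map_span, ← Ideal.mem_comap,
      Ideal.comap_map_of_surjective _ Ideal.Quotient.mk_surjective, ← RingHom.ker_eq_comap_bot,
      Ideal.mk_ker, sup_comm]
  refine ⟨_, hmem, isRegular_pair ?_ ?_ ?_, ?_⟩
  · intro x hx
    obtain ⟨F, rfl⟩ := Ideal.Quotient.mk_surjective x
    rw [← map_mul, Ideal.Quotient.eq_zero_iff_mem] at hx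
    exact Ideal.Quotient.eq_zero_iff_mem.2 (mem_of_linForm_mul_mem hc hx)
  · intro x hx
    obtain ⟨F, rfl⟩ := Ideal.Quotient.mk_surjective x
    rw [← map_mul, hspan] at hx
    exact (hspan F).2 (mem_sup_of_mul_mem_sup hX hc he hμ hμ0 hx)
  · intro htop
    have hle : Ideal.span {Ideal.Quotient.mk I (linForm n c),
        Ideal.Quotient.mk I (MvPolynomial.rename Sum.inr μ)} ≤ m.map (Ideal.Quotient.mk I) := by
      rw [Ideal.span_le]
      intro x hx
      exact hmem x (by simpa using hx)
    have h1 : (1 : MvPolynomial (Fin (1 + 1) ⊕ Fin (n + 1)) k) ∈ m := by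
      have h1 : Ideal.Quotient.mk I 1 ∈ m.map (Ideal.Quotient.mk I) :=
        hle (htop ▸ Submodule.mem_top)
      rw [← Ideal.mem_comap, Ideal.comap_map_of_surjective _ Ideal.Quotient.mk_surjective,
        ← RingHom.ker_eq_comap_bot, Ideal.mk_ker, sup_eq_left.2 fun F hF => by
          rw [hmker]; exact constantCoeff_eq_zero_of_mem_vanishP2 hne hF] at h1
      exact h1
    rw [hmker, RingHom.mem_ker, map_one] at h1
    exact one_ne_zero h1
  · rw [ringKrullDim_quotient_vanishP2 hX hne]
    rfl

theorem snd_image_BX {n : ℕ} {X : Set (Pt k 1 × Pt k n)} (hne : X.Nonempty) :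
    Prod.snd '' BX k X = BY k X := by
  ext Q
  constructor
  · rintro ⟨p, hp, rfl⟩
    exact hp.2
  · intro hQ
    obtain ⟨p, hp⟩ := hne
    exact ⟨(p.1, Q), ⟨hQ p.1 ⟨p, hp, rfl⟩, hQ⟩, rfl⟩

theorem snd_image_subset {n : ℕ} (X : Set (Pt k 1 × Pt k n)) :
    Prod.snd '' X ⊆ Prod.snd '' AX k X ∪ BY k X := by
  rintro _ ⟨p, hp, rfl⟩
  by_cases h : p.2 ∈ BY k X
  · exact Or.inr h
  · exact Or.inl ⟨p, ⟨hp, fun hB => h hB.2⟩, rfl⟩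

end ProductPoints

/-- **Theorem.** Let `X ⊆ ℙ^1 × ℙ^n`, `n ≥ 2`, be a finite set of points without the
inclusion property, such that the points of `π₁(A_X)` and of `B_Y = π₁(B_X)` are generic in
`ℙ^n` (every subset of `π₁(A_X) ∪ B_Y` has generic Hilbert function).  If `N₁(X) ∈ 𝒟(X)`,
then `X` is ACM. -/
theorem acm_of_N1_mem_D [CharZero k] {n : ℕ} (hn : 2 ≤ n) (X : Set (Pt k 1 × Pt k n))
    (hfin : X.Finite) (hninc : ¬ InclusionProp k X)
    (hgen : ∀ Z : Set (Pt k n), Z ⊆ Prod.snd '' AX k X ∪ BY k X → GenericHF k Z)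
    (hN1 : N1 k X ∈ DX k X) :
    IsACM (vanishP2 k X) := by
  have hne : X.Nonempty := by
    by_contra h
    rw [Set.not_nonempty_iff_eq_empty] at h
    exact hninc fun P₁ P₂ => Or.inl fun Q hQ => by simp [levelImage, h] at hQ
  have hB := ProductPoints.snd_image_BX hne
  have hcard : (Prod.snd '' X).ncard ≤ N1 k X + N0 k X := by
    have hAfin : (Prod.snd '' AX k X).Finite := (hfin.subset Set.sdiff_subset).image _
    have hBfin : (BY k X).Finite := hB ▸ (hfin.subset (Set.sep_subset _ _)).image _
    refine (Set.ncard_le_ncard (ProductPoints.snd_image_subset X) (hAfin.union hBfin)).trans ?_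
    refine (Set.ncard_union_le _ _).trans ?_
    rw [N1, N0, hB, add_comm]
  obtain ⟨j, hj1, hj2⟩ := hN1
  refine ProductPoints.isACM_vanishP2 hfin hne fun e => ?_
  rcases le_or_gt (Nat.choose (e + n) n) (N1 k X) with h | h
  · refine Or.inl fun g hg hg0 => ProductPoints.eq_zero_of_hilbFn_eq_choose ?_ hg hg0
    rw [hgen _ Set.subset_union_right e, ← hB]
    exact min_eq_left h
  · right
    rw [hgen _ (ProductPoints.snd_image_subset X) e]
    refine min_eq_right (hcard.trans (hj2.trans (Nat.choose_le_choose n ?_)))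
    by_contra hlt
    have := Nat.choose_le_choose n (show e + n ≤ j by omega)
    omega

end
end

section
/- Let P_1 ≠ P_2 be two points of P^1 and let Q_1, Q_2, Q_3 be three generic points of P^2 (no two equal and not collinear). Then the set X = {P_1 × Q_1, P_2 × Q_2, P_1 × Q_3, P_2 × Q_3} ⊂ P^1 × P^2 does not have the (⋆)-property, but X is ACM. -/
noncomputable section

variable (k : Type) [Field k]

open MvPolynomial

section CommutativeAlgebra

variable {A : Type*} [CommRing A]

/-- The Krull dimension of `A ⧸ (I ⊓ J)` is bounded by those of `A ⧸ I` and `A ⧸ J`. -/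
theorem ringKrullDim_quotient_inf_le (I J : Ideal A) :
    ringKrullDim (A ⧸ (I ⊓ J)) ≤ max (ringKrullDim (A ⧸ I)) (ringKrullDim (A ⧸ J)) := by
  have restrict : ∀ {K : Ideal A} (p : LTSeries (PrimeSpectrum.zeroLocus (R := A) ↑(I ⊓ J))),
      K ≤ p.head.1.asIdeal → (p.length : WithBot ℕ∞) ≤ ringKrullDim (A ⧸ K) := by
    intro K p hp
    rw [ringKrullDim_quotient]
    exact Order.LTSeries.length_le_krullDim
      (LTSeries.mk (α := PrimeSpectrum.zeroLocus (R := A) ↑K) p.length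
        (fun i => ⟨(p i).1, fun x hx => LTSeries.head_le p i (hp hx)⟩)
        (fun i j hij => p.strictMono hij))
  rw [ringKrullDim_quotient (I ⊓ J)]
  refine iSup_le fun p => ?_
  rcases p.head.1.isPrime.inf_le.mp p.head.2 with h | h
  · exact (restrict p h).trans (le_max_left _ _)
  · exact (restrict p h).trans (le_max_right _ _)

theorem isRegular_pair {a b : A} (ha : ∀ x, a * x = 0 → x = 0)
    (hb : ∀ x y, b * x = a * y → ∃ z, x = a * z) (hab : Ideal.ofList [a, b] ≠ ⊤) :
    RingTheory.Sequence.IsRegular A [a, b] where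
  toIsWeaklyRegular := by
    rw [RingTheory.Sequence.isWeaklyRegular_cons_iff,
      RingTheory.Sequence.isWeaklyRegular_singleton_iff]
    refine ⟨isSMulRegular_iff_right_eq_zero_of_smul.mpr ha, ?_⟩
    rw [isSMulRegular_quotient_iff_mem_of_smul_mem]
    intro x hx
    obtain ⟨y, -, hy⟩ := (Submodule.mem_smul_pointwise_iff_exists _ _ _).mp hx
    obtain ⟨z, rfl⟩ := hb x y hy.symm
    exact Submodule.smul_mem_pointwise_smul z a ⊤ trivial
  top_ne_smul := by simpa using hab.symm

end CommutativeAlgebra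

section PlanePolynomials

variable {k : Type} [Field k]

/-- A relation `X₁ f = X₀ h` in `k[X₀, X₁]` comes from a common factor. -/
theorem exists_eq_X_mul_of_X_mul_eq {f h : MvPolynomial (Fin 2) k}
    (hfh : X 1 * f = X 0 * h) : ∃ u, f = X 0 * u ∧ h = X 1 * u := by
  have hdvd : (X 0 : MvPolynomial (Fin 2) k) ∣ f := by
    refine ((X_prime (i := (0 : Fin 2))).dvd_or_dvd ⟨h, hfh⟩).resolve_left ?_
    rintro ⟨c, hc⟩
    simpa using congrArg (eval (![0, 1] : Fin 2 → k)) hc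
  obtain ⟨u, rfl⟩ := hdvd
  refine ⟨u, rfl, mul_left_cancel₀ (X_ne_zero (R := k) (0 : Fin 2)) ?_⟩
  rw [← hfh]
  ring

theorem map_aeval_pair {B C : Type*} [CommRing B] [CommRing C] [Algebra k B] [Algebra k C]
    (φ : B →ₐ[k] C) (p q : B) (u : MvPolynomial (Fin 2) k) :
    φ (aeval ![p, q] u) = aeval ![φ p, φ q] u := by
  rw [← AlgHom.comp_apply, comp_aeval]
  congr 2
  ext i
  fin_cases i <;> rfl

theorem aeval_X_pair (u : MvPolynomial (Fin 2) k) : aeval ![X 0, X 1] u = u := by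
  have : (![X 0, X 1] : Fin 2 → MvPolynomial (Fin 2) k) = X := by
    ext1 i
    fin_cases i <;> rfl
  rw [this, aeval_X_left_apply]

end PlanePolynomials

section ConePlanes

variable {k : Type} [Field k] {a b : ℕ}

/-- Restriction of polynomials to the plane spanned by `v` and `w` in `k^(a+1) × k^(b+1)`. -/
def conePlane (v : Fin (a + 1) → k) (w : Fin (b + 1) → k) :
    MvPolynomial (Fin (a + 1) ⊕ Fin (b + 1)) k →ₐ[k] MvPolynomial (Fin 2) k :=
  aeval (Sum.elim (fun i => C (v i) * X 0) (fun j => C (w j) * X 1))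

/-- The linear form of degree `(1, 0)` with coefficients `c`. -/
def leftForm (c : Fin (a + 1) → k) : MvPolynomial (Fin (a + 1) ⊕ Fin (b + 1)) k :=
  ∑ i, C (c i) * X (Sum.inl i)

/-- The linear form of degree `(0, 1)` with coefficients `d`. -/
def rightForm (d : Fin (b + 1) → k) : MvPolynomial (Fin (a + 1) ⊕ Fin (b + 1)) k :=
  ∑ j, C (d j) * X (Sum.inr j)

theorem leftForm_mem (c : Fin (a + 1) → k) :
    (leftForm c : MvPolynomial (Fin (a + 1) ⊕ Fin (b + 1)) k) ∈ Ideal.span (Set.range X) :=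
  Ideal.sum_mem _ fun _ _ => Ideal.mul_mem_left _ _ (Ideal.subset_span ⟨_, rfl⟩)

theorem rightForm_mem (d : Fin (b + 1) → k) :
    (rightForm d : MvPolynomial (Fin (a + 1) ⊕ Fin (b + 1)) k) ∈ Ideal.span (Set.range X) :=
  Ideal.sum_mem _ fun _ _ => Ideal.mul_mem_left _ _ (Ideal.subset_span ⟨_, rfl⟩)

theorem conePlane_leftForm (v c : Fin (a + 1) → k) (w : Fin (b + 1) → k) :
    conePlane v w (leftForm c) = C (c ⬝ᵥ v) * X 0 := by
  simp [conePlane, leftForm, dotProduct, Finset.sum_mul, mul_assoc]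

theorem conePlane_rightForm (v : Fin (a + 1) → k) (w d : Fin (b + 1) → k) :
    conePlane v w (rightForm d) = C (d ⬝ᵥ w) * X 1 := by
  simp [conePlane, rightForm, dotProduct, Finset.sum_mul, mul_assoc]

theorem eval_conePlane (v : Fin (a + 1) → k) (w : Fin (b + 1) → k) (x : Fin 2 → k)
    (f : MvPolynomial (Fin (a + 1) ⊕ Fin (b + 1)) k) :
    eval x (conePlane v w f) = eval (Sum.elim (x 0 • v) (x 1 • w)) f := by
  rw [conePlane, ← coe_aeval_eq_eval, ← coe_aeval_eq_eval, RingHom.coe_coe, RingHom.coe_coe,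
    ← AlgHom.comp_apply, comp_aeval]
  congr 2
  ext i
  rcases i with i | i <;> simp [mul_comm]

theorem aeval_X_zero_conePlane (v : Fin (a + 1) → k) (w w' : Fin (b + 1) → k)
    (f : MvPolynomial (Fin (a + 1) ⊕ Fin (b + 1)) k) :
    aeval (![X 0, 0] : Fin 2 → MvPolynomial (Fin 2) k) (conePlane v w f) =
      aeval (![X 0, 0] : Fin 2 → MvPolynomial (Fin 2) k) (conePlane v w' f) := by
  have h : (aeval (![X 0, 0] : Fin 2 → MvPolynomial (Fin 2) k)).comp (conePlane v w) =
      (aeval ![X 0, 0]).comp (conePlane v w') := by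
    ext1 i
    rcases i with i | i <;> simp [conePlane]
  exact DFunLike.congr_fun h f

theorem aeval_zero_X_conePlane (v v' : Fin (a + 1) → k) (w : Fin (b + 1) → k)
    (f : MvPolynomial (Fin (a + 1) ⊕ Fin (b + 1)) k) :
    aeval (![0, X 1] : Fin 2 → MvPolynomial (Fin 2) k) (conePlane v w f) =
      aeval (![0, X 1] : Fin 2 → MvPolynomial (Fin 2) k) (conePlane v' w f) := by
  have h : (aeval (![0, X 1] : Fin 2 → MvPolynomial (Fin 2) k)).comp (conePlane v w) =
      (aeval ![0, X 1]).comp (conePlane v' w) := by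
    ext1 i
    rcases i with i | i <;> simp [conePlane]
  exact DFunLike.congr_fun h f

theorem conePlane_surjective {v c : Fin (a + 1) → k} {w d : Fin (b + 1) → k}
    (hc : c ⬝ᵥ v = 1) (hd : d ⬝ᵥ w = 1) : Function.Surjective (conePlane v w) := fun u =>
  ⟨aeval ![leftForm c, rightForm d] u, by
    rw [map_aeval_pair, conePlane_leftForm, conePlane_rightForm, hc, hd]
    simpa using aeval_X_pair u⟩

theorem ringKrullDim_quotient_ker_conePlane {v c : Fin (a + 1) → k} {w d : Fin (b + 1) → k}
    (hc : c ⬝ᵥ v = 1) (hd : d ⬝ᵥ w = 1) :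
    ringKrullDim (MvPolynomial (Fin (a + 1) ⊕ Fin (b + 1)) k ⧸ RingHom.ker (conePlane v w)) =
      2 := by
  rw [ringKrullDim_eq_of_ringEquiv
      (Ideal.quotientKerAlgEquivOfSurjective (conePlane_surjective hc hd)).toRingEquiv,
    MvPolynomial.ringKrullDim_of_isNoetherianRing, ringKrullDim_eq_zero_of_field]
  simp

theorem mem_vanishP2_iff_s12 [Infinite k] {X : Set (Pt k a × Pt k b)}
    {f : MvPolynomial (Fin (a + 1) ⊕ Fin (b + 1)) k} :
    f ∈ vanishP2 k X ↔ ∀ p ∈ X, conePlane p.1.rep p.2.rep f = 0 := by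
  simp only [vanishP2, Ideal.mem_iInf, RingHom.mem_ker]
  refine forall₂_congr fun p _ => ⟨fun h => MvPolynomial.funext fun x => ?_, fun h s t => ?_⟩
  · simpa [eval_conePlane] using h (x 0) (x 1)
  · simpa [h] using (eval_conePlane p.1.rep p.2.rep ![s, t] f).symm

/-- Four polynomials on the planes of a path `Q₁ - P₁ - Q₃ - P₂ - Q₂` which agree along
the common lines glue to a polynomial on the whole space. -/
theorem exists_glue_conePlane {v₁ v₂ c₁ c₂ : Fin (a + 1) → k}
    {w₁ w₂ w₃ d₁ d₂ d₃ : Fin (b + 1) → k}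
    (hc₁₁ : c₁ ⬝ᵥ v₁ = 1) (hc₁₂ : c₁ ⬝ᵥ v₂ = 0) (hc₂₁ : c₂ ⬝ᵥ v₁ = 0) (hc₂₂ : c₂ ⬝ᵥ v₂ = 1)
    (hd₁₁ : d₁ ⬝ᵥ w₁ = 1) (hd₁₂ : d₁ ⬝ᵥ w₂ = 0) (hd₁₃ : d₁ ⬝ᵥ w₃ = 0)
    (hd₂₁ : d₂ ⬝ᵥ w₁ = 0) (hd₂₂ : d₂ ⬝ᵥ w₂ = 1) (hd₂₃ : d₂ ⬝ᵥ w₃ = 0)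
    (hd₃₁ : d₃ ⬝ᵥ w₁ = 0) (hd₃₂ : d₃ ⬝ᵥ w₂ = 0) (hd₃₃ : d₃ ⬝ᵥ w₃ = 1)
    {u₁ u₂ u₃ u₄ : MvPolynomial (Fin 2) k}
    (h₁₃ : aeval (![X 0, 0] : Fin 2 → MvPolynomial (Fin 2) k) u₁ = aeval ![X 0, 0] u₃)
    (h₂₄ : aeval (![X 0, 0] : Fin 2 → MvPolynomial (Fin 2) k) u₂ = aeval ![X 0, 0] u₄)
    (h₃₄ : aeval (![0, X 1] : Fin 2 → MvPolynomial (Fin 2) k) u₃ = aeval ![0, X 1] u₄) :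
    ∃ u, conePlane v₁ w₁ u = u₁ ∧ conePlane v₂ w₂ u = u₂ ∧ conePlane v₁ w₃ u = u₃ ∧
      conePlane v₂ w₃ u = u₄ := by
  have h₀ : aeval (![0, 0] : Fin 2 → MvPolynomial (Fin 2) k) u₃ = aeval ![0, 0] u₄ := by
    simpa only [map_aeval_pair, map_zero, aeval_X, Matrix.cons_val_zero, Matrix.cons_val_one]
      using congrArg (aeval (![X 0, 0] : Fin 2 → MvPolynomial (Fin 2) k)) h₃₄
  refine ⟨aeval ![leftForm c₁, rightForm d₃] u₃ +
    (aeval ![leftForm c₂, rightForm d₃] u₄ - aeval ![0, rightForm d₃] u₄) +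
    (aeval ![leftForm c₁, rightForm d₁] u₁ - aeval ![leftForm c₁, 0] u₁) +
    (aeval ![leftForm c₂, rightForm d₂] u₂ - aeval ![leftForm c₂, 0] u₂), ?_, ?_, ?_, ?_⟩ <;>
  simp only [map_add, map_sub, map_aeval_pair, conePlane_leftForm, conePlane_rightForm, map_zero,
    map_one, zero_mul, one_mul, aeval_X_pair, *] <;>
  ring

/-- The union of the four planes of a path `Q₁ - P₁ - Q₃ - P₂ - Q₂` is Cohen–Macaulay. -/
theorem isACM_of_conePlane_path {v₁ v₂ c₁ c₂ : Fin (a + 1) → k}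
    {w₁ w₂ w₃ d₁ d₂ d₃ : Fin (b + 1) → k}
    (hc₁₁ : c₁ ⬝ᵥ v₁ = 1) (hc₁₂ : c₁ ⬝ᵥ v₂ = 0) (hc₂₁ : c₂ ⬝ᵥ v₁ = 0) (hc₂₂ : c₂ ⬝ᵥ v₂ = 1)
    (hd₁₁ : d₁ ⬝ᵥ w₁ = 1) (hd₁₂ : d₁ ⬝ᵥ w₂ = 0) (hd₁₃ : d₁ ⬝ᵥ w₃ = 0)
    (hd₂₁ : d₂ ⬝ᵥ w₁ = 0) (hd₂₂ : d₂ ⬝ᵥ w₂ = 1) (hd₂₃ : d₂ ⬝ᵥ w₃ = 0)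
    (hd₃₁ : d₃ ⬝ᵥ w₁ = 0) (hd₃₂ : d₃ ⬝ᵥ w₂ = 0) (hd₃₃ : d₃ ⬝ᵥ w₃ = 1) :
    IsACM (RingHom.ker (conePlane v₁ w₁) ⊓ (RingHom.ker (conePlane v₂ w₂) ⊓
      (RingHom.ker (conePlane v₁ w₃) ⊓ RingHom.ker (conePlane v₂ w₃)))) := by
  set I := RingHom.ker (conePlane v₁ w₁) ⊓ (RingHom.ker (conePlane v₂ w₂) ⊓
      (RingHom.ker (conePlane v₁ w₃) ⊓ RingHom.ker (conePlane v₂ w₃)))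
  have mem_I : ∀ f, f ∈ I ↔ conePlane v₁ w₁ f = 0 ∧ conePlane v₂ w₂ f = 0 ∧
      conePlane v₁ w₃ f = 0 ∧ conePlane v₂ w₃ f = 0 := fun f => Iff.rfl
  have mk_eq : ∀ f g, Ideal.Quotient.mk I f = Ideal.Quotient.mk I g ↔
      conePlane v₁ w₁ f = conePlane v₁ w₁ g ∧ conePlane v₂ w₂ f = conePlane v₂ w₂ g ∧
      conePlane v₁ w₃ f = conePlane v₁ w₃ g ∧ conePlane v₂ w₃ f = conePlane v₂ w₃ g := by
    intro f g
    simp only [Ideal.Quotient.eq, mem_I, map_sub, sub_eq_zero]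
  set θ : MvPolynomial (Fin (a + 1) ⊕ Fin (b + 1)) k := leftForm (c₁ + c₂)
  set η : MvPolynomial (Fin (a + 1) ⊕ Fin (b + 1)) k := rightForm (d₁ + d₂ + d₃)
  have θ_left : ∀ w : Fin (b + 1) → k, conePlane v₁ w θ = X 0 := fun w => by
    simp [θ, conePlane_leftForm, add_dotProduct, *]
  have θ_right : ∀ w : Fin (b + 1) → k, conePlane v₂ w θ = X 0 := fun w => by
    simp [θ, conePlane_leftForm, add_dotProduct, *]
  have η₁ : ∀ v : Fin (a + 1) → k, conePlane v w₁ η = X 1 := fun v => by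
    simp [η, conePlane_rightForm, add_dotProduct, *]
  have η₂ : ∀ v : Fin (a + 1) → k, conePlane v w₂ η = X 1 := fun v => by
    simp [η, conePlane_rightForm, add_dotProduct, *]
  have η₃ : ∀ v : Fin (a + 1) → k, conePlane v w₃ η = X 1 := fun v => by
    simp [η, conePlane_rightForm, add_dotProduct, *]
  have cancel₀ : ∀ {p q : MvPolynomial (Fin 2) k}, aeval (![X 0, 0] : Fin 2 → _) (X 0 * p) =
      aeval (![X 0, 0] : Fin 2 → MvPolynomial (Fin 2) k) (X 0 * q) →
      aeval (![X 0, 0] : Fin 2 → MvPolynomial (Fin 2) k) p = aeval ![X 0, 0] q := by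
    intro p q h
    simpa using h
  have cancel₁ : ∀ {p q : MvPolynomial (Fin 2) k}, aeval (![0, X 1] : Fin 2 → _) (X 1 * p) =
      aeval (![0, X 1] : Fin 2 → MvPolynomial (Fin 2) k) (X 1 * q) →
      aeval (![0, X 1] : Fin 2 → MvPolynomial (Fin 2) k) p = aeval ![0, X 1] q := by
    intro p q h
    simpa using h
  refine ⟨[Ideal.Quotient.mk I θ, Ideal.Quotient.mk I η], ?_, isRegular_pair ?_ ?_ ?_, ?_⟩
  · simp only [List.mem_cons, List.not_mem_nil, or_false, forall_eq_or_imp, forall_eq]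
    exact ⟨Ideal.mem_map_of_mem _ (leftForm_mem _), Ideal.mem_map_of_mem _ (rightForm_mem _)⟩
  · intro x hx
    obtain ⟨f, rfl⟩ := Ideal.Quotient.mk_surjective x
    rw [← map_mul, ← map_zero (Ideal.Quotient.mk I), mk_eq] at hx
    rw [← map_zero (Ideal.Quotient.mk I), mk_eq]
    simpa [θ_left, θ_right] using hx
  · intro x y hxy
    obtain ⟨f, rfl⟩ := Ideal.Quotient.mk_surjective x
    obtain ⟨h, rfl⟩ := Ideal.Quotient.mk_surjective y
    simp only [← map_mul, mk_eq] at hxy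
    simp only [map_mul, θ_left, θ_right, η₁, η₂, η₃] at hxy
    obtain ⟨e₁, e₂, e₃, e₄⟩ := hxy
    obtain ⟨u₁, hf₁, hh₁⟩ := exists_eq_X_mul_of_X_mul_eq e₁
    obtain ⟨u₂, hf₂, hh₂⟩ := exists_eq_X_mul_of_X_mul_eq e₂
    obtain ⟨u₃, hf₃, hh₃⟩ := exists_eq_X_mul_of_X_mul_eq e₃
    obtain ⟨u₄, hf₄, hh₄⟩ := exists_eq_X_mul_of_X_mul_eq e₄
    have h₁₃ := aeval_X_zero_conePlane v₁ w₁ w₃ f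
    have h₂₄ := aeval_X_zero_conePlane v₂ w₂ w₃ f
    have h₃₄ := aeval_zero_X_conePlane v₁ v₂ w₃ h
    rw [hf₁, hf₃] at h₁₃
    rw [hf₂, hf₄] at h₂₄
    rw [hh₃, hh₄] at h₃₄
    obtain ⟨u, hu₁, hu₂, hu₃, hu₄⟩ := exists_glue_conePlane hc₁₁ hc₁₂ hc₂₁ hc₂₂ hd₁₁ hd₁₂ hd₁₃
      hd₂₁ hd₂₂ hd₂₃ hd₃₁ hd₃₂ hd₃₃ (cancel₀ h₁₃) (cancel₀ h₂₄) (cancel₁ h₃₄)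
    refine ⟨Ideal.Quotient.mk I u, ?_⟩
    rw [← map_mul, mk_eq]
    simp only [map_mul, θ_left, θ_right, hu₁, hu₂, hu₃, hu₄]
    exact ⟨hf₁, hf₂, hf₃, hf₄⟩
  · let ε : MvPolynomial (Fin (a + 1) ⊕ Fin (b + 1)) k ⧸ I →+* k :=
      Ideal.Quotient.lift I ((eval (0 : Fin 2 → k)).comp (conePlane v₁ w₁ : _ →+* _)) fun f hf => by
        simp [((mem_I f).mp hf).1]
    refine ne_top_of_le_ne_top (RingHom.ker_ne_top ε) (Ideal.span_le.mpr ?_)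
    rintro r hr
    have hr' : r = Ideal.Quotient.mk I θ ∨ r = Ideal.Quotient.mk I η := by simpa using hr
    rcases hr' with rfl | rfl <;> simp [ε, RingHom.mem_ker, θ_left, η₁]
  · have d₁' := ringKrullDim_quotient_ker_conePlane hc₁₁ hd₁₁
    have d₂' := ringKrullDim_quotient_ker_conePlane hc₂₂ hd₂₂
    have d₃' := ringKrullDim_quotient_ker_conePlane hc₁₁ hd₃₃
    have d₄' := ringKrullDim_quotient_ker_conePlane hc₂₂ hd₃₃
    have upper : ringKrullDim (MvPolynomial (Fin (a + 1) ⊕ Fin (b + 1)) k ⧸ I) ≤ 2 := by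
      refine (ringKrullDim_quotient_inf_le _ _).trans (max_le d₁'.le ?_)
      refine (ringKrullDim_quotient_inf_le _ _).trans (max_le d₂'.le ?_)
      exact (ringKrullDim_quotient_inf_le _ _).trans (max_le d₃'.le d₄'.le)
    have lower : 2 ≤ ringKrullDim (MvPolynomial (Fin (a + 1) ⊕ Fin (b + 1)) k ⧸ I) :=
      d₁'.ge.trans (ringKrullDim_le_of_surjective
        (Ideal.Quotient.factor (inf_le_left : I ≤ RingHom.ker (conePlane v₁ w₁)))
        (Ideal.Quotient.factor_surjective _))
    exact le_antisymm lower upper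

end ConePlanes

section DualForms

variable {k : Type} [Field k]

/-- An invertible matrix provides linear forms dual to its rows. -/
theorem exists_dual_rows {n : Type*} [Fintype n] [DecidableEq n] {M : Matrix n n k}
    (hM : IsUnit M) : ∃ N : Matrix n n k, ∀ i j, N i ⬝ᵥ M j = if i = j then 1 else 0 := by
  have hdet := (Matrix.isUnit_iff_isUnit_det M).mp hM
  refine ⟨M⁻¹.transpose, fun i j => ?_⟩
  have := congrFun (congrFun (Matrix.mul_nonsing_inv M hdet) j) i
  rw [Matrix.mul_apply'] at this
  rw [dotProduct_comm]
  exact this.trans (by simp only [Matrix.one_apply, eq_comm])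

theorem isUnit_of_rep_ne {P₁ P₂ : Pt k 1} (hP : P₁ ≠ P₂) :
    IsUnit (Matrix.of ![P₁.rep, P₂.rep]) := by
  rw [← Matrix.linearIndependent_rows_iff_isUnit]
  have h := Projectivization.independent_iff.mp 
    ((Projectivization.independent_pair_iff_ne _ _).mpr hP)
  convert! h using 1
  ext i : 1
  fin_cases i <;> rfl

theorem isUnit_of_not_collinear {m : ℕ} {Q : Fin (m + 1) → Pt k m}
    (hncol : ∀ ℓ : MvPolynomial (Fin (m + 1)) k, ℓ.IsHomogeneous 1 →
      (∀ i, ∀ s : k, eval (s • (Q i).rep) ℓ = 0) → ℓ = 0) :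
    IsUnit (Matrix.of fun i => (Q i).rep) := by
  rw [Matrix.isUnit_iff_isUnit_det, isUnit_iff_ne_zero]
  intro hdet
  obtain ⟨v, hv, hMv⟩ := Matrix.exists_mulVec_eq_zero_iff.mpr hdet
  refine hv (funext fun j => ?_)
  have hℓ := hncol (∑ j, C (v j) * X j)
    (IsHomogeneous.sum _ _ _ fun j _ => by
      simpa using (isHomogeneous_C _ (v j)).mul (isHomogeneous_X k j))
    (fun i s => by
      have := congrArg (s * ·) (congrFun hMv i)
      simpa [Matrix.mulVec, dotProduct, Finset.mul_sum, mul_comm, mul_left_comm] using this)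
  simpa [Pi.single_apply] using congrArg (eval (Pi.single j (1 : k))) hℓ

end DualForms

/-- **Example (four ACM points without the `(⋆)`-property).** Let `P₁ ≠ P₂` be points of
`ℙ^1` and let `Q₁, Q₂, Q₃` be generic points of `ℙ^2` (pairwise distinct and not collinear).
Then `X = {P₁×Q₁, P₂×Q₂, P₁×Q₃, P₂×Q₃} ⊆ ℙ^1 × ℙ^2` does not have the `(⋆)`-property,
but `X` is ACM. -/
theorem four_points_ACM_not_star [CharZero k] (P₁ P₂ : Pt k 1) (hP : P₁ ≠ P₂)
    (Q₁ Q₂ Q₃ : Pt k 2) (hQ12 : Q₁ ≠ Q₂) (hQ13 : Q₁ ≠ Q₃) (hQ23 : Q₂ ≠ Q₃)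
    (hncol : ∀ ℓ : MvPolynomial (Fin (2 + 1)) k, ℓ.IsHomogeneous 1 →
      (∀ s : k, MvPolynomial.eval (s • Q₁.rep) ℓ = 0) →
      (∀ s : k, MvPolynomial.eval (s • Q₂.rep) ℓ = 0) →
      (∀ s : k, MvPolynomial.eval (s • Q₃.rep) ℓ = 0) → ℓ = 0) :
    ¬ StarProp k ({(P₁, Q₁), (P₂, Q₂), (P₁, Q₃), (P₂, Q₃)} : Set (Pt k 1 × Pt k 2)) ∧
    IsACM (vanishP2 k ({(P₁, Q₁), (P₂, Q₂), (P₁, Q₃), (P₂, Q₃)} : Set (Pt k 1 × Pt k 2))) := by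
 
  have : Infinite k := inferInstance
  refine ⟨fun h => ?_, ?_⟩
  · have := h (P₁, Q₁) (by simp) (P₂, Q₂) (by simp)
    simp [hP, hP.symm, hQ12, hQ12.symm, hQ13, hQ23] at this
  · obtain ⟨c, hc⟩ := exists_dual_rows (isUnit_of_rep_ne hP)
    obtain ⟨d, hd⟩ := exists_dual_rows (isUnit_of_not_collinear (Q := ![Q₁, Q₂, Q₃])
      fun ℓ hℓ h => hncol ℓ hℓ (h 0) (h 1) (h 2))
    convert isACM_of_conePlane_path (hc 0 0) (hc 0 1) (hc 1 0) (hc 1 1) (hd 0 0) (hd 0 1)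
      (hd 0 2) (hd 1 0) (hd 1 1) (hd 1 2) (hd 2 0) (hd 2 1) (hd 2 2) using 1
    ext f
    simp only [mem_vanishP2_iff_s12, Set.mem_insert_iff, Set.mem_singleton_iff, forall_eq_or_imp,
      forall_eq]
    rfl


end
end
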